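/- Let (R,m) be a Noetherian local ring, let M be a finitely generated R-module of dimension s ≥ 2, and let Q be a parameter ideal for M. If M is unmixed, then M is a Cohen-Macaulay R-module if and only if e_1(Q,M) = 0. -/

import Mathlib

open Finset IsLocalRing

/-- The length of an `R`-module `M`: the Krull dimension of its lattice of submodules,
i.e. the supremum of the lengths of chains of submodules of `M`. -/
noncomputable def moduleLength (R M : Type*) [CommRing R] [AddCommGroup M] [Module R M] :
    WithBot ℕ∞ :=
  Order.krullDim (Submodule R M)

/-- `e 0, …, e s` are the Hilbert coefficients of a module `M` relative to an ideal `Q`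
(`s` the dimension of `M`): for all large `n`,
`λ(M ⧸ Q^(n+1) M) = ∑_{i=0}^{s} (-1)^i (e i) C(n+s-i, s-i)`. -/
def HasHilbertCoeffsMod {R : Type*} (M : Type*) [CommRing R] [AddCommGroup M] [Module R M]
    (Q : Ideal R) (s : ℕ) (e : ℕ → ℤ) : Prop :=
  ∃ N : ℕ, ∀ n ≥ N, ∃ l : ℕ,
    moduleLength R (M ⧸ (Q ^ (n + 1) • ⊤ : Submodule R M)) = (l : WithBot ℕ∞) ∧
    (l : ℤ) = ∑ i ∈ Finset.range (s + 1), (-1 : ℤ) ^ i * e i * ((n + s - i).choose (s - i))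

/-- A parameter ideal for a module `M` of dimension `s`: an ideal generated by `s` elements
of the maximal ideal with `λ(M/QM) < ∞`. -/
def IsParameterIdealFor {R : Type*} [CommRing R] [IsLocalRing R]
    (M : Type*) [AddCommGroup M] [Module R M] (s : ℕ) (Q : Ideal R) : Prop :=
  (∃ x : Fin s → R, (∀ i, x i ∈ maximalIdeal R) ∧ Q = Ideal.span (Set.range x)) ∧
    ∃ l : ℕ, moduleLength R (M ⧸ (Q • ⊤ : Submodule R M)) = (l : WithBot ℕ∞)

/-- A finitely generated module `M` of dimension `s` is unmixed if `dim(R̂/p) = s = dim M̂`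
for every associated prime `p` of the `m`-adic completion `M̂` of `M` over `R̂`. -/
def IsUnmixedModule (R M : Type*) [CommRing R] [IsLocalRing R] [AddCommGroup M] [Module R M]
    (s : ℕ) : Prop :=
  ∀ p ∈ associatedPrimes (AdicCompletion (maximalIdeal R) R)
      (AdicCompletion (maximalIdeal R) M),
    ringKrullDim (AdicCompletion (maximalIdeal R) R ⧸ p) = (s : WithBot ℕ∞)

/-- A module `M` of dimension `s` is Cohen-Macaulay if its depth equals its dimension,
equivalently, if there is an `M`-regular sequence of length `s` in the maximal ideal. -/
def IsCohenMacaulayModule (R M : Type*) [CommRing R] [IsLocalRing R] [AddCommGroup M]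
    [Module R M] (s : ℕ) : Prop :=
  ∃ rs : List R, (∀ x ∈ rs, x ∈ maximalIdeal R) ∧
    RingTheory.Sequence.IsRegular M rs ∧ rs.length = s

set_option linter.unusedSectionVars false
set_option linter.style.haveILetI false

/-- `f (n + 1)` agrees for large `n` with the polynomial having Hilbert coefficients `e`. -/
def HasCoeffs (f : ℕ → ℤ) (s : ℕ) (e : ℕ → ℤ) : Prop :=
  ∃ N : ℕ, ∀ n ≥ N, f (n + 1) =
    ∑ i ∈ Finset.range (s + 1), (-1 : ℤ) ^ i * e i * ((n + s - i).choose (s - i))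

/-- `f n = O(n ^ (r - 1))`, where `r = 0` means that `f` is eventually `O(1 / n)`. -/
def GrowthLE (r : ℕ) (f : ℕ → ℤ) : Prop :=
  ∃ C : ℤ, ∀ n : ℕ, |f n| * (n + 1) ≤ C * (n + 1) ^ r

theorem GrowthLE.mono {r r' : ℕ} (h : r ≤ r') {f : ℕ → ℤ} (hf : GrowthLE r f) :
    GrowthLE r' f := by
  obtain ⟨C, hC⟩ := hf
  refine ⟨|C|, fun n => (hC n).trans ?_⟩
  have h1 : (1 : ℤ) ≤ n + 1 := by omega
  have : ((n : ℤ) + 1) ^ r ≤ (n + 1) ^ r' := pow_le_pow_right₀ h1 h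
  calc C * ((n : ℤ) + 1) ^ r ≤ |C| * (n + 1) ^ r := by gcongr; exact le_abs_self C
    _ ≤ _ := by gcongr

theorem GrowthLE.of_eventually {r : ℕ} {f : ℕ → ℤ} {C : ℤ} {N : ℕ}
    (h : ∀ n ≥ N, |f n| * (n + 1) ≤ C * (n + 1) ^ r) : GrowthLE r f := by
  refine ⟨|C| + ∑ i ∈ Finset.range N, |f i| * (i + 1), fun n => ?_⟩
  have h1 : (1 : ℤ) ≤ (n + 1) ^ r := one_le_pow₀ (by omega)
  have h0 : (0 : ℤ) ≤ ∑ i ∈ Finset.range N, |f i| * (i + 1) :=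
    Finset.sum_nonneg fun i _ => by positivity
  rcases le_or_gt N n with hn | hn
  · refine (h n hn).trans ?_
    gcongr
    linarith [le_abs_self C]
  · have : |f n| * ((n : ℤ) + 1) ≤ ∑ i ∈ Finset.range N, |f i| * (i + 1) :=
      Finset.single_le_sum (f := fun i : ℕ => |f i| * ((i : ℤ) + 1))
        (fun i _ => by positivity) (Finset.mem_range.2 hn)
    nlinarith [abs_nonneg C]

theorem GrowthLE.of_le {r : ℕ} {f g : ℕ → ℤ} (hg : GrowthLE r g) (hfg : ∀ n, |f n| ≤ |g n|) :
    GrowthLE r f := by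
  obtain ⟨C, hC⟩ := hg
  exact ⟨C, fun n => le_trans (mul_le_mul_of_nonneg_right (hfg n) (by omega)) (hC n)⟩

theorem GrowthLE.add {r : ℕ} {f g : ℕ → ℤ} (hf : GrowthLE r f) (hg : GrowthLE r g) :
    GrowthLE r (fun n => f n + g n) := by
  obtain ⟨C, hC⟩ := hf
  obtain ⟨D, hD⟩ := hg
  refine ⟨C + D, fun n => ?_⟩
  have := abs_add_le (f n) (g n)
  have h1 : (0 : ℤ) < n + 1 := by omega
  nlinarith [hC n, hD n]

theorem GrowthLE.shift {r : ℕ} {f : ℕ → ℤ} (hf : GrowthLE r f) (k : ℕ) :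
    GrowthLE r (fun n => f (n + k)) := by
  obtain ⟨C, hC⟩ := hf
  refine ⟨|C| * (k + 1) ^ r, fun n => ?_⟩
  have h := hC (n + k)
  push_cast at h
  have h2 : ((n : ℤ) + k + 1) ^ r ≤ ((k + 1) * (n + 1)) ^ r := by
    gcongr; nlinarith [Int.natCast_nonneg n, Int.natCast_nonneg k]
  calc |f (n + k)| * ((n : ℤ) + 1) ≤ |f (n + k)| * (n + k + 1) := by gcongr; omega
    _ ≤ C * ((n : ℤ) + k + 1) ^ r := h
    _ ≤ |C| * ((n : ℤ) + k + 1) ^ r := by gcongr; exact le_abs_self C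
    _ ≤ |C| * ((k + 1) * (n + 1)) ^ r := by gcongr
    _ = _ := by rw [mul_pow]; ring

/-- If `f` is zero for small arguments one may also shift backwards. -/
theorem GrowthLE.of_shift {r : ℕ} {f : ℕ → ℤ} {k : ℕ} (hf : GrowthLE r (fun n => f (n + k))) :
    GrowthLE r f := by
  obtain ⟨C, hC⟩ := hf
  refine GrowthLE.of_eventually (C := |C| * (k + 1)) (N := k) fun n hn => ?_
  obtain ⟨m, rfl⟩ := Nat.exists_eq_add_of_le' hn
  have h := hC m
  push_cast
  have h2 : ((m : ℤ) + 1) ^ r ≤ ((m : ℤ) + k + 1) ^ r := by gcongr; omega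
  calc |f (m + k)| * ((m : ℤ) + k + 1) ≤ |f (m + k)| * ((k + 1) * (m + 1)) := by
        gcongr; nlinarith [Int.natCast_nonneg m, Int.natCast_nonneg k]
    _ = (k + 1) * (|f (m + k)| * (m + 1)) := by ring
    _ ≤ (k + 1) * (C * ((m : ℤ) + 1) ^ r) := by gcongr
    _ ≤ (k + 1) * (|C| * ((m : ℤ) + 1) ^ r) := by gcongr; exact le_abs_self C
    _ ≤ (k + 1) * (|C| * ((m : ℤ) + k + 1) ^ r) := by gcongr
    _ = _ := by ring

theorem HasCoeffs.congr {f g : ℕ → ℤ} {s : ℕ} {e : ℕ → ℤ} (hf : HasCoeffs f s e) {N : ℕ}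
    (h : ∀ n ≥ N, f n = g n) : HasCoeffs g s e := by
  obtain ⟨M, hM⟩ := hf
  exact ⟨max M N, fun n hn => by
    rw [← h (n + 1) (by have := le_max_right M N; omega)]
    exact hM n ((le_max_left _ _).trans hn)⟩

theorem HasCoeffs.sub {f g : ℕ → ℤ} {s : ℕ} {e e' : ℕ → ℤ} (hf : HasCoeffs f s e)
    (hg : HasCoeffs g s e') : HasCoeffs (fun n => f n - g n) s (fun i => e i - e' i) := by
  obtain ⟨M, hM⟩ := hf
  obtain ⟨N, hN⟩ := hg
  refine ⟨max M N, fun n hn => ?_⟩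
  simp only [hM n ((le_max_left _ _).trans hn), hN n ((le_max_right _ _).trans hn)]
  rw [← Finset.sum_sub_distrib]
  exact Finset.sum_congr rfl fun i _ => by ring

theorem HasCoeffs.diff {f g : ℕ → ℤ} {s : ℕ} {e : ℕ → ℤ} (hf : HasCoeffs f (s + 1) e) {N : ℕ}
    (h : ∀ n ≥ N, f (n + 1) = f n + g (n + 1)) : HasCoeffs g s e := by
  obtain ⟨M, hM⟩ := hf
  refine ⟨M + N + 1, fun n hn => ?_⟩
  obtain ⟨n, rfl⟩ : ∃ m, n = m + 1 := ⟨n - 1, by omega⟩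
  have h1 := h (n + 1 + 1) (by omega)
  have h1 := h (n + 1) (by omega)
  rw [hM (n + 1) (by omega), hM n (by omega)] at h1
  have h2 : g (n + 1 + 1) = ∑ i ∈ Finset.range (s + 1 + 1), ((-1 : ℤ) ^ i * e i *
      ((n + 1 + (s + 1) - i).choose (s + 1 - i)) -
      (-1 : ℤ) ^ i * e i * ((n + (s + 1) - i).choose (s + 1 - i))) := by
    rw [Finset.sum_sub_distrib]; linarith
  rw [h2, Finset.sum_range_succ]
  simp only [Nat.sub_self, Nat.choose_zero_right, sub_self, add_zero]
  refine Finset.sum_congr rfl fun i hi => ?_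
  have hi : i ≤ s := by simpa [Nat.lt_succ_iff] using hi
  have e1 : n + 1 + (s + 1) - i = (n + (s + 1) - i) + 1 := by omega
  have e2 : s + 1 - i = (s - i) + 1 := by omega
  have e3 : n + 1 + s - i = n + (s + 1) - i := by omega
  rw [e1, e2, e3, Nat.choose_succ_succ]
  push_cast
  ring

theorem HasCoeffs.sum {f g : ℕ → ℤ} {s : ℕ} {e : ℕ → ℤ} (hg : HasCoeffs g s e) {N : ℕ}
    (h : ∀ n ≥ N, f (n + 1) = f n + g (n + 1)) :
    ∃ e', HasCoeffs f (s + 1) e' ∧ ∀ i ≤ s, e' i = e i := by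
  obtain ⟨M, hM⟩ := hg
  set P : ℕ → ℤ := fun n => ∑ i ∈ Finset.range (s + 1),
    (-1 : ℤ) ^ i * e i * ((n + (s + 1) - i).choose (s + 1 - i)) with hP
  have hstep : ∀ n ≥ M + N, f (n + 1 + 1) - P (n + 1) = f (n + 1) - P n := by
    intro n hn
    have : P (n + 1) - P n = g (n + 1 + 1) := by
      rw [hM (n + 1) (by omega), hP, ← Finset.sum_sub_distrib]
      refine Finset.sum_congr rfl fun i hi => ?_
      have hi : i ≤ s := by simpa [Nat.lt_succ_iff] using hi
      have e1 : n + 1 + (s + 1) - i = (n + (s + 1) - i) + 1 := by omega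
      have e2 : s + 1 - i = (s - i) + 1 := by omega
      have e3 : n + 1 + s - i = n + (s + 1) - i := by omega
      rw [e1, e2, e3, Nat.choose_succ_succ]
      push_cast
      ring
    have := h (n + 1) (by omega)
    linarith
  have hconst : ∀ k, f (M + N + k + 1) - P (M + N + k) = f (M + N + 1) - P (M + N) := by
    intro k
    induction k with
    | zero => rfl
    | succ k ih => rw [← ih, ← hstep (M + N + k) (by omega)]; rfl
  refine ⟨fun i => if i ≤ s then e i else (-1) ^ (s + 1) * (f (M + N + 1) - P (M + N)),
    ⟨M + N, fun n hn => ?_⟩, fun i hi => by simp [hi]⟩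
  obtain ⟨k, rfl⟩ := Nat.exists_eq_add_of_le hn
  have := hconst k
  rw [Finset.sum_range_succ]
  have h3 : (-1 : ℤ) ^ (s + 1) * (-1) ^ (s + 1) = 1 := by
    rw [← mul_pow]; simp
  have h4 : ∑ i ∈ Finset.range (s + 1), (-1 : ℤ) ^ i *
      (if i ≤ s then e i else (-1) ^ (s + 1) * (f (M + N + 1) - P (M + N))) *
      ((M + N + k + (s + 1) - i).choose (s + 1 - i)) = P (M + N + k) := by
    refine Finset.sum_congr rfl fun i hi => ?_
    have hi : i ≤ s := by simpa [Nat.lt_succ_iff] using hi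
    simp [hi]
  rw [h4]
  simp only [Nat.sub_self, Nat.choose_zero_right, ← mul_assoc, h3, add_le_iff_nonpos_right,
    Nat.le_zero_eq, one_ne_zero, if_false]
  push_cast
  linarith

theorem HasCoeffs.unique {s : ℕ} : ∀ {f : ℕ → ℤ} {e e' : ℕ → ℤ}, HasCoeffs f s e →
    HasCoeffs f s e' → ∀ i ≤ s, e i = e' i := by
  induction s with
  | zero =>
    rintro f e e' ⟨N, hN⟩ ⟨N', hN'⟩ i hi
    obtain rfl : i = 0 := by omega
    have h1 := hN (max N N') (le_max_left _ _)
    have h2 := hN' (max N N') (le_max_right _ _)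
    simp at h1 h2
    linarith
  | succ s ih =>
    intro f e e' h h'
    have key : ∀ i ≤ s, e i = e' i := by
      have hg : ∀ n ≥ 0, f (n + 1) = f n + (fun m => f m - f (m - 1)) (n + 1) := by simp
      exact ih (h.diff (N := 0) (g := fun m => f m - f (m - 1)) hg)
        (h'.diff (N := 0) (g := fun m => f m - f (m - 1)) hg)
    intro i hi
    rcases hi.lt_or_eq with hi | rfl
    · exact key i (by omega)
    · obtain ⟨N, hN⟩ := h
      obtain ⟨N', hN'⟩ := h'
      have h1 := hN (max N N') (le_max_left _ _)
      have h2 := hN' (max N N') (le_max_right _ _)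
      rw [Finset.sum_range_succ] at h1 h2
      have : ∑ x ∈ Finset.range (s + 1), (-1 : ℤ) ^ x * e x *
            ((max N N' + (s + 1) - x).choose (s + 1 - x)) = ∑ x ∈ Finset.range (s + 1),
            (-1 : ℤ) ^ x * e' x * ((max N N' + (s + 1) - x).choose (s + 1 - x)) :=
        Finset.sum_congr rfl fun i hi => by
          rw [key i (by simpa [Nat.lt_succ_iff] using hi)]
      rw [h1, this] at h2
      simp at h2
      exact h2

theorem choose_le_succ_pow (n k : ℕ) : (n + k).choose k ≤ (n + 1) ^ k := by
  induction k with
  | zero => simp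
  | succ k ih =>
    have h := Nat.add_one_mul_choose_eq (n + k) k
    have : (n + (k + 1)).choose (k + 1) * (k + 1) ≤ (n + 1) ^ (k + 1) * (k + 1) := by
      rw [show n + (k + 1) = n + k + 1 by ring, ← h, pow_succ]
      calc (n + k + 1) * (n + k).choose k ≤ ((n + 1) * (k + 1)) * (n + 1) ^ k := by
            gcongr; nlinarith
        _ = _ := by ring
    exact Nat.le_of_mul_le_mul_right this (by omega)

theorem succ_pow_le_choose (n k : ℕ) : (n + 1) ^ k ≤ k.factorial * (n + k).choose k := by
  rw [← Nat.descFactorial_eq_factorial_mul_choose]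
  exact le_trans (by gcongr; omega) (Nat.pow_sub_le_descFactorial (n + k) k)

theorem HasCoeffs.leading {f : ℕ → ℤ} {s i : ℕ} {e : ℕ → ℤ} (hf : HasCoeffs f s e)
    (hi : i ≤ s) (h0 : ∀ j < i, e j = 0) :
    ∃ A : ℤ, 0 ≤ A ∧ ∃ N, ∀ n ≥ N,
      |f (n + 1) - (-1) ^ i * e i * ((n + (s - i)).choose (s - i))| * (n + 1) ≤
        A * (n + 1) ^ (s - i) := by
  obtain ⟨N, hN⟩ := hf
  refine ⟨∑ j ∈ Finset.range (s - i), |e (i + 1 + j)|,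
    Finset.sum_nonneg fun _ _ => abs_nonneg _, N, fun n hn => ?_⟩
  rw [hN n hn, show s + 1 = i + (1 + (s - i)) by omega, Finset.sum_range_add,
    Finset.sum_eq_zero (s := Finset.range i), Finset.sum_range_add, Finset.sum_range_one]
  · rw [show n + s - (i + 0) = n + (s - i) by omega, show s - (i + 0) = s - i by omega]
    simp only [add_zero, zero_add, add_sub_cancel_left]
    rw [Finset.sum_mul]
    refine le_trans (mul_le_mul_of_nonneg_right (Finset.abs_sum_le_sum_abs _ _) (by omega)) ?_
    rw [Finset.sum_mul]
    refine Finset.sum_le_sum fun j hj => ?_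
    have hj : j < s - i := by simpa using hj
    rw [abs_mul, abs_mul, abs_pow, abs_neg, abs_one, one_pow, one_mul, ← add_assoc, mul_assoc]
    gcongr
    rw [Nat.abs_cast, show n + s - (i + 1 + j) = n + (s - (i + 1 + j)) by omega]
    have h1 := choose_le_succ_pow n (s - (i + 1 + j))
    calc (((n + (s - (i + 1 + j))).choose (s - (i + 1 + j)) : ℕ) : ℤ) * ((n : ℤ) + 1)
        ≤ ((n + 1) ^ (s - (i + 1 + j)) : ℕ) * ((n : ℤ) + 1) := by gcongr
      _ = ((n : ℤ) + 1) ^ (s - (i + 1 + j) + 1) := by push_cast; ring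
      _ ≤ _ := pow_le_pow_right₀ (by omega) (by omega)
  · intro j hj
    rw [h0 j (by simpa using hj)]
    simp

theorem eq_zero_of_forall_mul_succ_le {a B : ℤ} {k N : ℕ}
    (h : ∀ n : ℕ, n ≥ N → a * ((n + k).choose k) * (n + 1) ≤ B * (n + 1) ^ k) : a ≤ 0 := by
  by_contra! ha
  set B' := (k.factorial : ℤ) * |B|
  have key : ∀ n : ℕ, n ≥ N → a * (n + 1) ≤ B' := by
    intro n hn
    have h1 : ((n : ℤ) + 1) ^ k ≤ k.factorial * (n + k).choose k := by
      exact_mod_cast succ_pow_le_choose n k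
    have h2 := h n hn
    have hp : (0 : ℤ) < (n + 1) ^ k := by positivity
    have h3 : (a * (n + 1)) * ((n : ℤ) + 1) ^ k ≤ B' * (n + 1) ^ k := by
      calc (a * (n + 1)) * ((n : ℤ) + 1) ^ k
          ≤ (a * (n + 1)) * (k.factorial * (n + k).choose k) := by gcongr
        _ = k.factorial * (a * ((n + k).choose k) * (n + 1)) := by ring
        _ ≤ k.factorial * (B * (n + 1) ^ k) := by gcongr
        _ ≤ k.factorial * (|B| * (n + 1) ^ k) := by gcongr; exact le_abs_self B
        _ = _ := by ring
    exact le_of_mul_le_mul_right h3 hp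
  have hB : (0 : ℤ) ≤ B' := by positivity
  have := key (N + B'.toNat) (by omega)
  push_cast at this
  rw [Int.toNat_of_nonneg hB] at this
  nlinarith [Int.natCast_nonneg N]

theorem HasCoeffs.eq_zero_of_growthLE {f : ℕ → ℤ} {s r : ℕ} {e : ℕ → ℤ} (hf : HasCoeffs f s e)
    (hg : GrowthLE r f) {i : ℕ} (hi : i + r ≤ s) : e i = 0 := by
  induction i using Nat.strong_induction_on with
  | _ i ih =>
    obtain ⟨A, hA0, N, hA⟩ := hf.leading (i := i) (by omega) fun j hj => ih j hj (by omega)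
    obtain ⟨C, hC⟩ := (hg.shift 1).mono (show r ≤ s - i by omega)
    have key : ∀ n ≥ N, |e i| * ((n + (s - i)).choose (s - i)) * ((n : ℤ) + 1) ≤
        (A + C) * (n + 1) ^ (s - i) := by
      intro n hn
      have h1 := hA n hn
      have h2 := hC n
      set X := (-1) ^ i * e i * ((n + (s - i)).choose (s - i) : ℤ) with hX
      have h3 : |X| = |e i| * ((n + (s - i)).choose (s - i)) := by
        rw [hX, abs_mul, abs_mul]; simp
      have h4 : |X| ≤ |f (n + 1) - X| + |f (n + 1)| := by
        have := abs_sub_abs_le_abs_sub X (f (n + 1))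
        rw [abs_sub_comm] at this
        linarith
      rw [← h3]
      have h5 : (0 : ℤ) < n + 1 := by omega
      nlinarith
    have := eq_zero_of_forall_mul_succ_le key
    exact abs_eq_zero.1 (le_antisymm this (abs_nonneg _))

theorem HasCoeffs.growthLE {f : ℕ → ℤ} {s r : ℕ} {e : ℕ → ℤ} (hf : HasCoeffs f s e)
    (he : ∀ i, i + r ≤ s → e i = 0) : GrowthLE r f := by
  have hsh : GrowthLE r (fun n => f (n + 1)) := by
    rcases lt_or_ge s r with hr | hr
    · obtain ⟨A, hA0, N, hA⟩ := hf.leading (i := 0) (by omega) (by simp)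
      refine GrowthLE.mono (r := s + 1) (by omega) ?_
      refine GrowthLE.of_eventually (C := A + |e 0|) (N := N) fun n hn => ?_
      have h1 := hA n hn
      set X := (-1) ^ 0 * e 0 * ((n + (s - 0)).choose (s - 0) : ℤ) with hX
      have h3 : |X| ≤ |e 0| * (n + 1) ^ s := by
        rw [hX, abs_mul, abs_mul]
        simp only [pow_zero, abs_one, one_mul, Nat.abs_cast, Nat.sub_zero]
        gcongr
        exact_mod_cast choose_le_succ_pow n s
      have h4 : |f (n + 1)| ≤ |f (n + 1) - X| + |X| := by
        have := abs_sub_abs_le_abs_sub (f (n + 1)) X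
        linarith
      have h5 : (0 : ℤ) < n + 1 := by omega
      have h6 : (0 : ℤ) < (n + 1) ^ s := by positivity
      rw [Nat.sub_zero] at h1
      have h7 : A * ((n : ℤ) + 1) ^ s ≤ A * (n + 1) ^ (s + 1) := by
        gcongr; all_goals omega
      have h8 : |X| * ((n : ℤ) + 1) ≤ |e 0| * (n + 1) ^ (s + 1) := by
        rw [pow_succ, ← mul_assoc]; gcongr
      nlinarith
    · obtain ⟨A, hA0, N, hA⟩ := hf.leading (i := s - r) (by omega)
        (fun j hj => he j (by omega))
      refine GrowthLE.of_eventually (C := A) (N := N) fun n hn => ?_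
      have h1 := hA n hn
      rw [he (s - r) (by omega)] at h1
      simpa [show s - (s - r) = r by omega] using h1
  exact hsh.of_shift

theorem HasCoeffs.nonpos_of_nonneg {f : ℕ → ℤ} {s : ℕ} {e : ℕ → ℤ} (hf : HasCoeffs f s e)
    (hs : 1 ≤ s) (h0 : e 0 = 0) (hpos : ∀ n, 0 ≤ f n) : e 1 ≤ 0 := by
  obtain ⟨A, hA0, N, hA⟩ := hf.leading (i := 1) hs (by intro j hj; rwa [Nat.lt_one_iff.1 hj])
  refine eq_zero_of_forall_mul_succ_le (B := A) (k := s - 1) (N := N) fun n hn => ?_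
  refine le_trans ?_ (hA n hn)
  gcongr
  have := le_abs_self (f (n + 1) - (-1) ^ 1 * e 1 * ((n + (s - 1)).choose (s - 1) : ℤ))
  have := hpos (n + 1)
  linarith

section HilbertSamuel

variable {R : Type*} [CommRing R] [IsLocalRing R]
  {M N L : Type*} [AddCommGroup M] [Module R M] [AddCommGroup N] [Module R N]
  [AddCommGroup L] [Module R L]

/-- `Q + ann M` contains a power of the maximal ideal. -/
def IsIdealOfDefinition (Q : Ideal R) (M : Type*) [AddCommGroup M] [Module R M] : Prop :=
  ∃ a, maximalIdeal R ^ a ≤ Q ⊔ Module.annihilator R M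

theorem IsIdealOfDefinition.of_injective {Q : Ideal R} (h : IsIdealOfDefinition Q M)
    (f : N →ₗ[R] M) (hf : Function.Injective f) : IsIdealOfDefinition Q N := by
  obtain ⟨a, ha⟩ := h
  exact ⟨a, ha.trans (sup_le_sup_left (f.annihilator_le_of_injective hf) _)⟩

theorem IsIdealOfDefinition.of_surjective {Q : Ideal R} (h : IsIdealOfDefinition Q M)
    (f : M →ₗ[R] N) (hf : Function.Surjective f) : IsIdealOfDefinition Q N := by
  obtain ⟨a, ha⟩ := h
  exact ⟨a, ha.trans (sup_le_sup_left (f.annihilator_le_of_surjective hf) _)⟩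

theorem IsIdealOfDefinition.submodule {Q : Ideal R} (h : IsIdealOfDefinition Q M)
    (K : Submodule R M) : IsIdealOfDefinition Q K :=
  h.of_injective K.subtype K.injective_subtype

theorem IsIdealOfDefinition.quotient {Q : Ideal R} (h : IsIdealOfDefinition Q M)
    (K : Submodule R M) : IsIdealOfDefinition Q (M ⧸ K) :=
  h.of_surjective K.mkQ K.mkQ_surjective

theorem isFiniteLength_of_pow_le_annihilator [IsNoetherianRing R] [Module.Finite R M] {a : ℕ}
    (h : maximalIdeal R ^ a ≤ Module.annihilator R M) : IsFiniteLength R M := by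
  rw [isFiniteLength_iff_isNoetherian_isArtinian]
  refine ⟨inferInstance, ?_⟩
  rcases subsingleton_or_nontrivial M with hM | hM
  · infer_instance
  set I := Module.annihilator R M
  have hI : I ≠ ⊤ := by
    rw [Ne, Module.annihilator_eq_top_iff]; exact not_subsingleton M
  have : Nontrivial (R ⧸ I) := Ideal.Quotient.nontrivial_iff.2 hI
  have hloc : IsLocalRing (R ⧸ I) :=
    IsLocalRing.of_surjective' (Ideal.Quotient.mk I) Ideal.Quotient.mk_surjective
  have : IsArtinianRing (R ⧸ I) := by
    rw [isArtinianRing_iff_isNilpotent_maximalIdeal]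
    refine ⟨a, ?_⟩
    rw [← IsLocalRing.map_maximalIdeal_of_surjective (Ideal.Quotient.mk I)
      Ideal.Quotient.mk_surjective, ← Ideal.map_pow, Ideal.zero_eq_bot,
      Ideal.map_eq_bot_iff_le_ker, Ideal.mk_ker]
    exact h
  have htors : Module.IsTorsionBySet R M I := fun m a => Module.mem_annihilator.1 a.2 m
  letI := htors.module
  haveI : IsScalarTower R (R ⧸ I) M := htors.isScalarTower
  haveI : Module.Finite (R ⧸ I) M := Module.Finite.of_restrictScalars_finite R _ _
  have h2 : IsArtinian (R ⧸ I) M := inferInstance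
  exact (LinearMap.isArtinian_iff_of_bijective (σ := Ideal.Quotient.mk I)
    (⟨⟨id, fun _ _ => rfl⟩, fun r m => rfl⟩ : M →ₛₗ[Ideal.Quotient.mk I] M)
    Function.bijective_id).2 h2

theorem exists_pow_le_sup_annihilator_pow {Q : Ideal R} (h : IsIdealOfDefinition Q M) (n : ℕ) :
    ∃ a, maximalIdeal R ^ a ≤ Q ^ n ⊔ Module.annihilator R M := by
  obtain ⟨a, ha⟩ := h
  refine ⟨a * n, ?_⟩
  rw [pow_mul]
  refine (Ideal.pow_right_mono ha n).trans ?_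
  induction n with
  | zero => simp
  | succ n ih =>
    rw [pow_succ]
    refine (Ideal.mul_mono_left ih).trans ?_
    generalize Module.annihilator R M = A
    rw [Ideal.mul_le]
    intro x hx y hy
    obtain ⟨x, hx1, a, ha, rfl⟩ := Submodule.mem_sup.1 hx
    obtain ⟨y, hy1, b, hb, rfl⟩ := Submodule.mem_sup.1 hy
    rw [show (x + a) * (y + b) = x * y + (x * b + (y + b) * a) by ring, pow_succ]
    exact Submodule.add_mem_sup (Ideal.mul_mem_mul hx1 hy1)
      (A.add_mem (A.mul_mem_left _ hb) (A.mul_mem_left _ ha))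

theorem IsIdealOfDefinition.isFiniteLength [IsNoetherianRing R] [Module.Finite R M]
    {Q : Ideal R} (h : IsIdealOfDefinition Q M) {n : ℕ} {K : Submodule R M}
    (hK : Q ^ n • ⊤ ≤ K) : IsFiniteLength R (M ⧸ K) := by
  obtain ⟨a, ha⟩ := exists_pow_le_sup_annihilator_pow h n
  refine isFiniteLength_of_pow_le_annihilator (a := a) (ha.trans (sup_le ?_ ?_))
  · intro q hq
    rw [Module.mem_annihilator]
    intro m
    obtain ⟨m, rfl⟩ := K.mkQ_surjective m
    rw [← map_smul]
    exact (Submodule.Quotient.mk_eq_zero _).2 (hK (Submodule.smul_mem_smul hq trivial))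
  · exact K.mkQ.annihilator_le_of_surjective K.mkQ_surjective

/-- The Hilbert–Samuel function `n ↦ λ(M / Q ^ n M)`, zero if the length is infinite. -/
noncomputable def hilbertSamuel (Q : Ideal R) (M : Type*) [AddCommGroup M] [Module R M]
    (n : ℕ) : ℕ :=
  (Module.length R (M ⧸ (Q ^ n • ⊤ : Submodule R M))).toNat

/-- The length of the quotient of `N` by the preimage of `Q ^ n M`. -/
noncomputable def imageLength (Q : Ideal R) (f : N →ₗ[R] M) (n : ℕ) : ℕ :=
  (Module.length R (N ⧸ (Q ^ n • ⊤ : Submodule R M).comap f)).toNat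

theorem pow_smul_top_le_comap (Q : Ideal R) (f : N →ₗ[R] M) (n : ℕ) :
    Q ^ n • ⊤ ≤ (Q ^ n • ⊤ : Submodule R M).comap f := by
  rw [← Submodule.map_le_iff_le_comap, Submodule.map_smul'']
  exact Submodule.smul_mono le_rfl le_top

variable [IsNoetherianRing R]

theorem length_toNat_le_of_surjective [Module.Finite R M]
    (h : IsFiniteLength R M) (f : M →ₗ[R] N) (hf : Function.Surjective f) :
    (Module.length R N).toNat ≤ (Module.length R M).toNat :=
  ENat.toNat_le_toNat (Module.length_le_of_surjective f hf) (Module.length_ne_top_iff.2 h)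

theorem imageLength_le_hilbertSamuel [Module.Finite R N] {Q : Ideal R}
    (h : IsIdealOfDefinition Q N) (f : N →ₗ[R] M) (n : ℕ) :
    imageLength Q f n ≤ hilbertSamuel Q N n :=
  length_toNat_le_of_surjective (h.isFiniteLength le_rfl)
    (Submodule.factor (pow_smul_top_le_comap Q f n)) (Submodule.factor_surjective _)

theorem hilbertSamuel_le_imageLength [Module.Finite R N] {Q : Ideal R}
    (h : IsIdealOfDefinition Q N) (f : N →ₗ[R] M) {n k : ℕ}
    (hk : (Q ^ n • ⊤ : Submodule R M).comap f ≤ Q ^ k • ⊤) :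
    hilbertSamuel Q N k ≤ imageLength Q f n :=
  length_toNat_le_of_surjective (h.isFiniteLength (pow_smul_top_le_comap Q f n))
    (Submodule.factor hk) (Submodule.factor_surjective _)

theorem hilbertSamuel_eq_add [Module.Finite R M] {Q : Ideal R} (h : IsIdealOfDefinition Q M)
    {f : N →ₗ[R] M} {g : M →ₗ[R] L} (hfg : Function.Exact f g) (hg : Function.Surjective g)
    (n : ℕ) : hilbertSamuel Q M n = hilbertSamuel Q L n + imageLength Q f n := by
  have hfin : IsFiniteLength R (M ⧸ (Q ^ n • ⊤ : Submodule R M)) := h.isFiniteLength le_rfl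
  set f' : (N ⧸ (Q ^ n • ⊤ : Submodule R M).comap f) →ₗ[R] (M ⧸ (Q ^ n • ⊤ : Submodule R M)) :=
    Submodule.mapQ _ _ f le_rfl
  set g' : (M ⧸ (Q ^ n • ⊤ : Submodule R M)) →ₗ[R] (L ⧸ (Q ^ n • ⊤ : Submodule R L)) :=
    Submodule.mapQ _ _ g (pow_smul_top_le_comap Q g n)
  have hf' : Function.Injective f' := by
    rw [← LinearMap.ker_eq_bot, Submodule.ker_mapQ]
    simp
  have hg' : Function.Surjective g' := by
    intro y
    obtain ⟨y, rfl⟩ := Submodule.mkQ_surjective _ y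
    obtain ⟨x, rfl⟩ := hg y
    exact ⟨Submodule.Quotient.mk x, rfl⟩
  have hex : Function.Exact f' g' := by
    intro y
    constructor
    · intro hy
      obtain ⟨y, rfl⟩ := Submodule.mkQ_surjective _ y
      have hy : g y ∈ (Q ^ n • ⊤ : Submodule R L) := by
        rwa [← Submodule.Quotient.mk_eq_zero]
      rw [← LinearMap.range_eq_top.2 hg, ← Submodule.map_top, ← Submodule.map_smul''] at hy
      obtain ⟨a, ha, hay⟩ := hy
      obtain ⟨b, hb⟩ := (hfg (y - a)).1 (by rw [map_sub, hay, sub_self])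
      refine ⟨Submodule.Quotient.mk b, ?_⟩
      change Submodule.Quotient.mk (f b) = Submodule.Quotient.mk y
      rw [Submodule.Quotient.eq, hb]
      simpa using ha
    · rintro ⟨x, rfl⟩
      obtain ⟨x, rfl⟩ := Submodule.mkQ_surjective _ x
      change Submodule.Quotient.mk (g (f x)) = 0
      rw [(hfg (f x)).2 ⟨x, rfl⟩]; rfl
  have := Module.length_eq_add_of_exact f' g' hf' hg' hex
  have h1 : Module.length R (N ⧸ (Q ^ n • ⊤ : Submodule R M).comap f) ≠ ⊤ :=
    Module.length_ne_top_iff.2 (hfin.of_injective hf')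
  have h2 : Module.length R (L ⧸ (Q ^ n • ⊤ : Submodule R L)) ≠ ⊤ :=
    Module.length_ne_top_iff.2 (hfin.of_surjective hg')
  rw [hilbertSamuel, this, ENat.toNat_add h1 h2, add_comm]
  rfl

theorem hilbertSamuel_mono [Module.Finite R M] {Q : Ideal R} (h : IsIdealOfDefinition Q M) :
    Monotone (hilbertSamuel Q M) := fun _ _ hmn =>
  length_toNat_le_of_surjective (h.isFiniteLength le_rfl)
    (Submodule.factor (Submodule.smul_mono_left (Ideal.pow_le_pow_right hmn)))
    (Submodule.factor_surjective _)

theorem hilbertSamuel_le_of_surjective [Module.Finite R M] {Q : Ideal R}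
    (h : IsIdealOfDefinition Q M) (g : M →ₗ[R] L) (hg : Function.Surjective g) (n : ℕ) :
    hilbertSamuel Q L n ≤ hilbertSamuel Q M n := by
  rw [hilbertSamuel_eq_add h g.exact_subtype_ker_map hg]
  exact Nat.le_add_right _ _

theorem hilbertSamuel_congr (Q : Ideal R) (e : M ≃ₗ[R] L) (n : ℕ) :
    hilbertSamuel Q M n = hilbertSamuel Q L n := by
  refine congrArg ENat.toNat (LinearEquiv.length_eq (Submodule.Quotient.equiv _ _ e ?_))
  change Submodule.map (e : M →ₗ[R] L) _ = _
  rw [Submodule.map_smul'', Submodule.map_top, LinearEquiv.range]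

theorem exists_forall_inf_le (Q : Ideal R) [Module.Finite R M] (K : Submodule R M) :
    ∃ k, ∀ n, Q ^ (n + k) • ⊤ ⊓ K ≤ Q ^ n • K := by
  obtain ⟨k, hk⟩ := Ideal.exists_pow_inf_eq_pow_smul Q K
  refine ⟨k, fun n => ?_⟩
  rw [hk (n + k) (by omega), Nat.add_sub_cancel]
  exact Submodule.smul_mono le_rfl inf_le_right

theorem exists_forall_comap_le (Q : Ideal R) [Module.Finite R M] (f : N →ₗ[R] M)
    (hf : Function.Injective f) :
    ∃ k, ∀ n, (Q ^ (n + k) • ⊤ : Submodule R M).comap f ≤ Q ^ n • ⊤ := by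
  obtain ⟨k, hk⟩ := exists_forall_inf_le Q (LinearMap.range f)
  refine ⟨k, fun n x hx => ?_⟩
  have := hk n ⟨hx, ⟨x, rfl⟩⟩
  rw [← Submodule.map_top, ← Submodule.map_smul''] at this
  obtain ⟨y, hy, hyx⟩ := this
  rwa [← hf hyx]

/-- The Hilbert–Samuel function is `O(n ^ (r - 1))`, i.e. `dim M < r`. -/
def DimLT (Q : Ideal R) (r : ℕ) (M : Type*) [AddCommGroup M] [Module R M] : Prop :=
  GrowthLE r (fun n => (hilbertSamuel Q M n : ℤ))

variable {Q : Ideal R} {r : ℕ}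

theorem DimLT.congr (e : M ≃ₗ[R] L) (h : DimLT Q r M) : DimLT Q r L := by
  unfold DimLT at *
  simpa only [← hilbertSamuel_congr Q e] using h

theorem DimLT.of_surjective [Module.Finite R M] (h : IsIdealOfDefinition Q M) (g : M →ₗ[R] L)
    (hg : Function.Surjective g) (hM : DimLT Q r M) : DimLT Q r L :=
  GrowthLE.of_le hM fun n => by
    simpa using hilbertSamuel_le_of_surjective h g hg n

theorem growthLE_hilbertSamuel_of_imageLength [Module.Finite R M] [Module.Finite R N]
    (h : IsIdealOfDefinition Q M)
    (f : N →ₗ[R] M) (hf : Function.Injective f)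
    (hM : GrowthLE r (fun n => (imageLength Q f n : ℤ))) : DimLT Q r N := by
  obtain ⟨k, hk⟩ := exists_forall_comap_le Q f hf
  refine GrowthLE.of_le (hM.shift k) fun n => ?_
  simpa using hilbertSamuel_le_imageLength (h.of_injective f hf) f (hk n)

theorem growthLE_imageLength [Module.Finite R M] (h : IsIdealOfDefinition Q M)
    (f : N →ₗ[R] M) (hM : DimLT Q r M) : GrowthLE r (fun n => (imageLength Q f n : ℤ)) :=
  GrowthLE.of_le hM fun n => by
    have := hilbertSamuel_eq_add h f.exact_map_mkQ_range (Submodule.mkQ_surjective _) n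
    simp only [this, Nat.abs_cast]
    push_cast
    omega

theorem DimLT.of_injective [Module.Finite R M] (h : IsIdealOfDefinition Q M) (f : N →ₗ[R] M)
    (hf : Function.Injective f) (hM : DimLT Q r M) : DimLT Q r N :=
  haveI : Module.Finite R N := Module.Finite.of_injective f hf
  growthLE_hilbertSamuel_of_imageLength h f hf (growthLE_imageLength h f hM)

theorem DimLT.of_exact [Module.Finite R M] [Module.Finite R N] (h : IsIdealOfDefinition Q M)
    (hN' : IsIdealOfDefinition Q N)
    {f : N →ₗ[R] M} {g : M →ₗ[R] L} (hfg : Function.Exact f g) (hg : Function.Surjective g)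
    (hN : DimLT Q r N) (hL : DimLT Q r L) : DimLT Q r M := by
  refine GrowthLE.of_le (hL.add hN) fun n => ?_
  rw [hilbertSamuel_eq_add h hfg hg n]
  have := imageLength_le_hilbertSamuel hN' f n
  rw [abs_of_nonneg (by positivity), abs_of_nonneg (by positivity)]
  push_cast
  gcongr

theorem DimLT.mono {r' : ℕ} (hr : r ≤ r') (h : DimLT Q r M) : DimLT Q r' M :=
  GrowthLE.mono hr h

theorem dimLT_zero_iff [Module.Finite R M] (hQ : Q ≤ maximalIdeal R)
    (h : IsIdealOfDefinition Q M) (h0 : DimLT Q 0 M) : Subsingleton M := by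
  obtain ⟨C, hC⟩ := h0
  have h1 : hilbertSamuel Q M 1 = 0 := by
    by_contra hne
    have h2 := hC (1 + C.toNat)
    have h3 := hilbertSamuel_mono h (show 1 ≤ 1 + C.toNat by omega)
    have h5 : (1 : ℤ) ≤ hilbertSamuel Q M (1 + C.toNat) := by omega
    rw [abs_of_nonneg (by positivity)] at h2
    simp only [pow_zero, mul_one] at h2
    push_cast at h2
    have := Int.self_le_toNat C
    nlinarith
  have h2 : IsFiniteLength R (M ⧸ (Q ^ 1 • ⊤ : Submodule R M)) := h.isFiniteLength le_rfl
  rw [hilbertSamuel, ENat.toNat_eq_zero] at h1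
  have h3 := h1.resolve_right (Module.length_ne_top_iff.2 h2)
  rw [Module.length_eq_zero_iff, Submodule.Quotient.subsingleton_iff, pow_one] at h3
  have h4 : (⊤ : Submodule R M) = ⊥ :=
    Submodule.eq_bot_of_le_smul_of_le_jacobson_bot Q ⊤ (Module.Finite.fg_top) h3.ge
      (hQ.trans (IsLocalRing.jacobson_eq_maximalIdeal ⊥ bot_ne_top).ge)
  exact (Submodule.subsingleton_iff R).1 (subsingleton_of_bot_eq_top h4.symm)

end HilbertSamuel

section Depth

open RingTheory.Sequence
open scoped Pointwise

variable {R : Type*} [CommRing R] [IsLocalRing R] [IsNoetherianRing R]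
  {M N L : Type*} [AddCommGroup M] [Module R M] [AddCommGroup N] [Module R N]
  [AddCommGroup L] [Module R L] {Q : Ideal R}

theorem exists_isSMulRegular_mem [Module.Finite R M] (I : Ideal R)
    (h : ∀ u : M, (∀ c ∈ I, c • u = 0) → u = 0) : ∃ y ∈ I, IsSMulRegular M y := by
  by_contra! hI
  obtain ⟨P, hP, hIP⟩ : ∃ P ∈ associatedPrimes R M, I ≤ P :=
    (I.subset_union_prime_finite (associatedPrimes.finite R M) (f := id) 0 0
      fun _ h _ _ ↦ h.1).1 <| by
      simp only [id]
      rw [biUnion_associatedPrimes_eq_compl_regular R M]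
      exact fun r hr ↦ hI r hr
  rw [AssociatedPrimes.mem_iff, isAssociatedPrime_iff] at hP
  obtain ⟨hp, x, rfl⟩ := hP
  have : x = 0 := h x fun c hc => by simpa [Submodule.mem_colon_singleton] using hIP hc
  exact hp.ne_top (by simp [this])

/-- There is a weakly regular sequence on `M` of length `s` in the maximal ideal. -/
def HasDepthGE (R : Type*) [CommRing R] [IsLocalRing R] (s : ℕ) (M : Type*) [AddCommGroup M]
    [Module R M] : Prop :=
  ∃ rs : List R, (∀ x ∈ rs, x ∈ maximalIdeal R) ∧ IsWeaklyRegular M rs ∧ rs.length = s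

theorem hasDepthGE_zero : HasDepthGE R 0 M := ⟨[], by simp, by simp, rfl⟩

theorem hasDepthGE_succ {s : ℕ} : HasDepthGE R (s + 1) M ↔
    ∃ x ∈ maximalIdeal R, IsSMulRegular M x ∧ HasDepthGE R s (QuotSMulTop x M) := by
  constructor
  · rintro ⟨rs, h1, h2, h3⟩
    cases rs with
    | nil => simp at h3
    | cons x rs =>
      rw [isWeaklyRegular_cons_iff] at h2
      exact ⟨x, h1 x (by simp), h2.1, rs, fun y hy => h1 y (by simp [hy]), h2.2,
        by simpa using h3⟩
  · rintro ⟨x, hx, hreg, rs, h1, h2, h3⟩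
    refine ⟨x :: rs, ?_, (isWeaklyRegular_cons_iff M x rs).2 ⟨hreg, h2⟩, by simp [h3]⟩
    intro y hy
    rcases List.mem_cons.1 hy with rfl | hy
    exacts [hx, h1 y hy]

theorem HasDepthGE.congr {s : ℕ} (e : M ≃ₗ[R] N) (h : HasDepthGE R s M) : HasDepthGE R s N := by
  obtain ⟨rs, h1, h2, h3⟩ := h
  exact ⟨rs, h1, (e.isWeaklyRegular_congr rs).1 h2, h3⟩

theorem isWeaklyRegular_swap [Module.Finite R M] {x y : R} {rs : List R}
    (h : IsWeaklyRegular M (x :: y :: rs)) (hx : x ∈ maximalIdeal R) (hy : y ∈ maximalIdeal R)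
    (hrs : ∀ z ∈ rs, z ∈ maximalIdeal R) : IsWeaklyRegular M (y :: x :: rs) := by
  refine IsLocalRing.isWeaklyRegular_of_perm_of_subset_maximalIdeal h (List.Perm.swap _ _ _) ?_
  simp only [List.mem_cons]
  rintro z (rfl | rfl | hz)
  exacts [hx, hy, hrs z hz]

theorem hasDepthGE_swap [Module.Finite R M] {x y : R} (hx : x ∈ maximalIdeal R)
    (hy : y ∈ maximalIdeal R) (hxM : IsSMulRegular M x) (hyM : IsSMulRegular (QuotSMulTop x M) y)
    {s : ℕ} (h : HasDepthGE R s (QuotSMulTop y (QuotSMulTop x M))) :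
    IsSMulRegular M y ∧ IsSMulRegular (QuotSMulTop y M) x ∧
      HasDepthGE R s (QuotSMulTop x (QuotSMulTop y M)) := by
  obtain ⟨rs, h1, h2, h3⟩ := h
  have h4 : IsWeaklyRegular M (x :: y :: rs) :=
    (isWeaklyRegular_cons_iff _ _ _).2 ⟨hxM, (isWeaklyRegular_cons_iff _ _ _).2 ⟨hyM, h2⟩⟩
  have h5 := (isWeaklyRegular_cons_iff _ _ _).1 (isWeaklyRegular_swap h4 hx hy h1)
  have h6 := (isWeaklyRegular_cons_iff _ _ _).1 h5.2
  exact ⟨h5.1, h6.1, rs, h1, h6.2, h3⟩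

theorem mem_smul_top_iff {x : R} {m : M} : m ∈ (x • ⊤ : Submodule R M) ↔ ∃ w, x • w = m := by
  simp [Submodule.mem_smul_pointwise_iff_exists]

/-- Two regular elements have quotients with zero socle simultaneously. -/
theorem socle_eq_zero_of_isSMulRegular {a x : R} (ha : IsSMulRegular M a)
    (hx : IsSMulRegular M x) {z : R} (hz : z ∈ maximalIdeal R)
    (ham : a ∈ maximalIdeal R)
    (hza : IsSMulRegular (QuotSMulTop a M) z) (u : QuotSMulTop x M)
    (hu : ∀ c ∈ maximalIdeal R, c • u = 0) : u = 0 := by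
  obtain ⟨u, rfl⟩ := Submodule.mkQ_surjective _ u
  have hu' : ∀ c ∈ maximalIdeal R, ∃ w, x • w = c • u := fun c hc => by
    rw [← mem_smul_top_iff, ← Submodule.Quotient.mk_eq_zero]
    exact hu c hc
  obtain ⟨v, hv⟩ := hu' a ham
  have hzv : ∃ w, a • w = z • v := by
    obtain ⟨w, hw⟩ := hu' z hz
    refine ⟨w, hx ?_⟩
    change x • a • w = x • z • v
    rw [smul_comm x a, hw, smul_comm x z, hv, smul_comm]
  rw [← mem_smul_top_iff] at hzv
  have hv2 := (isSMulRegular_quotient_iff_mem_of_smul_mem _ _).1 hza v hzv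
  obtain ⟨w, hw⟩ := mem_smul_top_iff.1 hv2
  have : x • w = u := ha (by
    change a • x • w = a • u
    rw [← hv, ← hw, smul_comm])
  exact (Submodule.Quotient.mk_eq_zero _).2 (mem_smul_top_iff.2 ⟨w, this⟩)

theorem HasDepthGE.quotSMulTop : ∀ {s : ℕ} {M : Type*} [AddCommGroup M] [Module R M]
    [Module.Finite R M], HasDepthGE R (s + 1) M → ∀ {x : R}, x ∈ maximalIdeal R →
    IsSMulRegular M x → HasDepthGE R s (QuotSMulTop x M) := by
  intro s
  induction s with
  | zero => intro M _ _ _ _ x _ _; exact hasDepthGE_zero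
  | succ s ih =>
    intro M _ _ _ h x hxm hx
    obtain ⟨a, ham, ha, h⟩ := hasDepthGE_succ.1 h
    obtain ⟨y, hym, hy, -⟩ := hasDepthGE_succ.1 h
    obtain ⟨z, hzm, hz⟩ := exists_isSMulRegular_mem
      (M := QuotSMulTop a M × QuotSMulTop x M) (maximalIdeal R) (by
        rintro ⟨u, v⟩ huv
        have hu : u = 0 := hy (by
          have := congrArg Prod.fst (huv y hym)
          change y • u = y • 0
          rw [smul_zero]; exact this)
        have hv : v = 0 := socle_eq_zero_of_isSMulRegular ha hx hym ham hy v
          fun c hc => congrArg Prod.snd (huv c hc)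
        rw [hu, hv]; rfl)
    have hz1 : IsSMulRegular (QuotSMulTop a M) z := fun u v huv => by
      have := @hz (u, 0) (v, 0) (by ext1; exacts [huv, rfl])
      exact congrArg Prod.fst this
    have hz2 : IsSMulRegular (QuotSMulTop x M) z := fun u v huv => by
      have := @hz (0, u) (0, v) (by ext1; exacts [rfl, huv])
      exact congrArg Prod.snd this
    obtain ⟨h1, h2, h3⟩ := hasDepthGE_swap ham hzm ha hz1 (ih h hzm hz1)
    have h4 : HasDepthGE R (s + 1) (QuotSMulTop z M) := hasDepthGE_succ.2 ⟨a, ham, h2, h3⟩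
    obtain ⟨-, h5, -⟩ := hasDepthGE_swap hxm hzm hx hz2 (s := 0) hasDepthGE_zero
    obtain ⟨-, -, h6⟩ := hasDepthGE_swap hzm hxm h1 h5 (ih h4 hxm h5)
    exact hasDepthGE_succ.2 ⟨z, hzm, hz2, h6⟩

theorem exact_lsmul_mkQ (x : R) (M : Type*) [AddCommGroup M] [Module R M] :
    Function.Exact (LinearMap.lsmul R M x) (Submodule.mkQ (x • ⊤ : Submodule R M)) := by
  intro m
  rw [Submodule.mkQ_apply, Submodule.Quotient.mk_eq_zero, mem_smul_top_iff]
  rfl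

theorem exists_hilbertSamuel_quotSMulTop_add_le [Module.Finite R M]
    (h : IsIdealOfDefinition Q M) {x : R} (hx : IsSMulRegular M x) :
    ∃ k, ∀ n, hilbertSamuel Q (QuotSMulTop x M) (n + k) + hilbertSamuel Q M n ≤
      hilbertSamuel Q M (n + k) := by
  obtain ⟨k, hk⟩ := exists_forall_comap_le Q (LinearMap.lsmul R M x) hx
  refine ⟨k, fun n => ?_⟩
  rw [hilbertSamuel_eq_add h (exact_lsmul_mkQ x M) (Submodule.mkQ_surjective _) (n + k)]
  gcongr
  exact hilbertSamuel_le_imageLength h _ (hk n)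

theorem DimLT.quotSMulTop [Module.Finite R M] (h : IsIdealOfDefinition Q M) {x : R}
    (hx : IsSMulRegular M x) {r : ℕ} (hM : DimLT Q (r + 1) M) :
    DimLT Q r (QuotSMulTop x M) := by
  obtain ⟨k, hk⟩ := exists_hilbertSamuel_quotSMulTop_add_le h hx
  have key : ∀ n j, j * hilbertSamuel Q (QuotSMulTop x M) n ≤ hilbertSamuel Q M (n + j * k) := by
    intro n j
    induction j with
    | zero => simp
    | succ j ih =>
      have h1 := hk (n + j * k)
      have h2 := hilbertSamuel_mono (h.quotient (x • ⊤)) (show n ≤ n + j * k + k by omega)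
      rw [show n + (j + 1) * k = n + j * k + k by ring]
      nlinarith
  obtain ⟨C, hC⟩ := hM
  refine ⟨C * (k + 1) ^ r, fun n => ?_⟩
  have h1 := key n (n + 1)
  have h2 := hC (n + (n + 1) * k)
  rw [Nat.abs_cast] at h2 ⊢
  set a := hilbertSamuel Q (QuotSMulTop x M) n
  have h3 : (((n + (n + 1) * k : ℕ) : ℤ) + 1) = (n + 1) * (k + 1) := by push_cast; ring
  rw [h3] at h2
  have h4 : (0 : ℤ) < (n + 1) * (k + 1) := by positivity
  have h5 : ((n : ℤ) + 1) * a ≤ hilbertSamuel Q M (n + (n + 1) * k) := by exact_mod_cast h1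
  have h6 : (a * ((n : ℤ) + 1)) * ((n + 1) * (k + 1)) ≤
      (C * (k + 1) ^ r * (n + 1) ^ r) * ((n + 1) * (k + 1)) := by
    calc (a * ((n : ℤ) + 1)) * ((n + 1) * (k + 1)) = ((n + 1) * a) * ((n + 1) * (k + 1)) := by ring
      _ ≤ hilbertSamuel Q M (n + (n + 1) * k) * ((n + 1) * (k + 1)) := by gcongr
      _ ≤ C * ((n + 1) * (k + 1)) ^ (r + 1) := h2
      _ = _ := by rw [pow_succ, mul_pow]; ring
  exact le_of_mul_le_mul_right h6 h4

theorem dimLT_succ_of_quotSMulTop [Module.Finite R M] (h : IsIdealOfDefinition Q M) {x : R}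
    (hxQ : x ∈ Q) {r : ℕ} (hM : DimLT Q r (QuotSMulTop x M)) : DimLT Q (r + 1) M := by
  have hstep : ∀ n, hilbertSamuel Q M (n + 1) ≤
      hilbertSamuel Q (QuotSMulTop x M) (n + 1) + hilbertSamuel Q M n := by
    intro n
    rw [hilbertSamuel_eq_add h (exact_lsmul_mkQ x M) (Submodule.mkQ_surjective _) (n + 1)]
    gcongr
    have hle : (Q ^ n • ⊤ : Submodule R M) ≤
        (Q ^ (n + 1) • ⊤ : Submodule R M).comap (LinearMap.lsmul R M x) := by
      intro m hm
      rw [Submodule.mem_comap, pow_succ', Submodule.mul_smul]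
      exact Submodule.smul_mem_smul hxQ hm
    exact length_toNat_le_of_surjective (h.isFiniteLength le_rfl) (Submodule.factor hle)
      (Submodule.factor_surjective hle)
  have h0 : hilbertSamuel Q M 0 = 0 := by
    have : Subsingleton (M ⧸ (Q ^ 0 • ⊤ : Submodule R M)) := by
      rw [Submodule.Quotient.subsingleton_iff]; simp
    simp [hilbertSamuel, Module.length_eq_zero]
  have key : ∀ n, hilbertSamuel Q M n ≤ n * hilbertSamuel Q (QuotSMulTop x M) n := by
    intro n
    induction n with
    | zero => simp [h0]
    | succ n ih =>
      have h2 := hilbertSamuel_mono (h.quotient (x • ⊤)) (Nat.le_succ n)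
      have := hstep n
      change _ ≤ hilbertSamuel Q (QuotSMulTop x M) _ at h2
      change hilbertSamuel Q (QuotSMulTop x M) _ ≤ _ at h2
      nlinarith
  obtain ⟨C, hC⟩ := hM
  refine ⟨C, fun n => ?_⟩
  have h1 := hC n
  rw [Nat.abs_cast] at h1 ⊢
  have h2 : (hilbertSamuel Q M n : ℤ) ≤ (n + 1) * hilbertSamuel Q (QuotSMulTop x M) n := by
    have := key n
    have h3 : hilbertSamuel Q M n ≤ (n + 1) * hilbertSamuel Q (QuotSMulTop x M) n := by nlinarith
    exact_mod_cast h3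
  calc (hilbertSamuel Q M n : ℤ) * (n + 1)
      ≤ ((n + 1) * hilbertSamuel Q (QuotSMulTop x M) n) * (n + 1) := by gcongr
    _ = (n + 1) * (hilbertSamuel Q (QuotSMulTop x M) n * (n + 1)) := by ring
    _ ≤ (n + 1) * (C * (n + 1) ^ r) := by gcongr
    _ = _ := by ring

/-- No nonzero submodule of `M` has dimension less than `s`. -/
def NoSmallSubmodule (Q : Ideal R) (s : ℕ) (M : Type*) [AddCommGroup M] [Module R M] : Prop :=
  ∀ K : Submodule R M, DimLT Q s K → K = ⊥

theorem subsingleton_of_quotSMulTop [Module.Finite R M] {x : R} (hx : x ∈ maximalIdeal R)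
    (h : Subsingleton (QuotSMulTop x M)) : Subsingleton M := by
  by_contra hM
  rw [not_subsingleton_iff_nontrivial] at hM
  exact not_subsingleton_iff_nontrivial.2 (nontrivial_quotSMulTop_of_mem_maximalIdeal M hx) h

theorem NoSmallSubmodule.of_dimLT [Module.Finite R M] {s : ℕ}
    (hM : NoSmallSubmodule Q s M) (f : N →ₗ[R] M) (hf : Function.Injective f)
    (hN : DimLT Q s N) : Subsingleton N := by
  have e := LinearEquiv.ofInjective f hf
  have := hM (LinearMap.range f) (hN.congr e)
  rw [LinearMap.range_eq_bot] at this
  subst this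
  exact ⟨fun a b => hf rfl⟩

theorem HasDepthGE.noSmallSubmodule (hQ : Q ≤ maximalIdeal R) : ∀ {s : ℕ} {M : Type*}
    [AddCommGroup M] [Module R M] [Module.Finite R M], IsIdealOfDefinition Q M →
    HasDepthGE R s M → NoSmallSubmodule Q s M := by
  intro s
  induction s with
  | zero =>
    intro M _ _ _ hd _ K hK
    exact (Submodule.subsingleton_iff_eq_bot).1 (dimLT_zero_iff hQ (hd.submodule K) hK)
  | succ s ih =>
    intro M _ _ _ hd hM K hK
    obtain ⟨x, hxm, hx, hdep⟩ := hasDepthGE_succ.1 hM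
    have hsmall := ih (hd.quotient (x • ⊤)) hdep
    let S : ℕ →o Submodule R M :=
      ⟨fun n => K.comap (LinearMap.lsmul R M (x ^ n)), by
        intro a b hab m hm
        obtain ⟨c, rfl⟩ := Nat.exists_eq_add_of_le' hab
        change x ^ (c + a) • m ∈ K
        rw [pow_add, mul_smul]
        exact K.smul_mem _ hm⟩
    obtain ⟨n, hn⟩ := monotone_stabilizes_iff_noetherian.2 (inferInstance : IsNoetherian R M) S
    have hreg : IsSMulRegular M (x ^ n) := hx.pow n
    have hS : DimLT Q (s + 1) (S n) := by
      refine DimLT.of_injective (hd.submodule K)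
        ((LinearMap.lsmul R M (x ^ n)).restrict (p := S n) (q := K) fun m hm => hm) ?_ hK
      intro a b hab
      exact Subtype.ext (hreg (congrArg Subtype.val hab))
    have hxS : IsSMulRegular (S n) x := fun a b hab =>
      Subtype.ext (hx (congrArg Subtype.val hab))
    have hq := hS.quotSMulTop (hd.submodule _) hxS
    let f : QuotSMulTop x (S n) →ₗ[R] QuotSMulTop x M := QuotSMulTop.map x (S n).subtype
    have hf : Function.Injective f := by
      rw [← LinearMap.ker_eq_bot, eq_bot_iff]
      intro u hu
      obtain ⟨u, rfl⟩ := Submodule.mkQ_surjective _ u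
      have hu : (u : M) ∈ (x • ⊤ : Submodule R M) := (Submodule.Quotient.mk_eq_zero _).1 hu
      obtain ⟨w, hw⟩ := mem_smul_top_iff.1 hu
      have hwS : w ∈ S n := by
        rw [hn (n + 1) (by omega)]
        change x ^ (n + 1) • w ∈ K
        rw [pow_succ, mul_smul, hw]
        exact u.2
      exact (Submodule.Quotient.mk_eq_zero _).2
        (mem_smul_top_iff.2 ⟨⟨w, hwS⟩, Subtype.ext hw⟩)
    have h1 := subsingleton_of_quotSMulTop hxm
      (hsmall.of_dimLT f hf hq)
    have h2 := (Submodule.subsingleton_iff_eq_bot).1 h1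
    rw [eq_bot_iff, ← h2]
    intro m hm
    exact K.smul_mem (x ^ n) hm

theorem exists_forall_apply_eq_smul (hQ : Q ≤ maximalIdeal R) [Module.Finite R M] {r : ℕ}
    (hd : IsIdealOfDefinition Q M) (hM : HasDepthGE R (r + 2) M) (I : Ideal R)
    (hdI : IsIdealOfDefinition Q (R ⧸ I))
    (hI : DimLT Q (r + 1) (R ⧸ I)) (φ : I →ₗ[R] M) : ∃ t : M, ∀ c : I, φ c = (c : R) • t := by
  have cyc : ∀ {N : Type _} [AddCommGroup N] [Module R N], NoSmallSubmodule Q (r + 1) N →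
      ∀ u : N, (∀ c ∈ I, c • u = 0) → u = 0 := by
    intro N _ _ hN u hu
    have hker : I ≤ LinearMap.ker (LinearMap.toSpanSingleton R N u) := fun c hc => hu c hc
    have h1 : DimLT Q (r + 1) (LinearMap.range (Submodule.liftQ I _ hker)) :=
      hI.of_surjective hdI (LinearMap.rangeRestrict _) (LinearMap.surjective_rangeRestrict _)
    have h2 := LinearMap.range_eq_bot.1 (hN _ h1)
    have := LinearMap.congr_fun h2 (Submodule.Quotient.mk 1)
    have h3 : (1 : R) • u = 0 := this
    rwa [one_smul] at h3
  rcases eq_or_ne I ⊤ with rfl | hne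
  · refine ⟨φ ⟨1, trivial⟩, fun c => ?_⟩
    rw [← map_smul]
    congr 1
    ext
    simp
  have hIm := IsLocalRing.le_maximalIdeal hne
  have hP : NoSmallSubmodule Q (r + 1) M := fun K hK =>
    hM.noSmallSubmodule hQ hd K (hK.mono (by omega))
  obtain ⟨y, hyI, hy⟩ := exists_isSMulRegular_mem I (cyc hP)
  have hdep := hM.quotSMulTop (hIm hyI) hy
  have h1 := cyc (hdep.noSmallSubmodule hQ (hd.quotient (y • ⊤)))
    (Submodule.Quotient.mk (φ ⟨y, hyI⟩)) (fun c hc => by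
      rw [← Submodule.Quotient.mk_smul, Submodule.Quotient.mk_eq_zero, mem_smul_top_iff]
      refine ⟨φ ⟨c, hc⟩, ?_⟩
      rw [← map_smul, ← map_smul]
      congr 1
      ext
      simp [mul_comm])
  obtain ⟨t, ht⟩ := mem_smul_top_iff.1 ((Submodule.Quotient.mk_eq_zero _).1 h1)
  refine ⟨t, fun c => hy ?_⟩
  change y • φ c = y • (c : R) • t
  rw [smul_comm y, ht, ← map_smul, ← map_smul]
  congr 1
  ext
  simp [mul_comm]

theorem DimLT.sup [Module.Finite R M] (hd : IsIdealOfDefinition Q M) {r : ℕ}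
    {K K' : Submodule R M} (hK : DimLT Q r K) (hK' : DimLT Q r K') :
    DimLT Q r (K ⊔ K' : Submodule R M) := by
  have h1 : DimLT Q r ((K ⊔ K' : Submodule R M) ⧸
      LinearMap.range (Submodule.inclusion (le_sup_left : K ≤ K ⊔ K'))) := by
    refine hK'.of_surjective (hd.submodule K')
      ((Submodule.mkQ _).comp (Submodule.inclusion le_sup_right)) ?_
    intro u
    obtain ⟨⟨u, hu⟩, rfl⟩ := Submodule.mkQ_surjective _ u
    obtain ⟨a, ha, b, hb, rfl⟩ := Submodule.mem_sup.1 hu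
    refine ⟨⟨b, hb⟩, ?_⟩
    refine (Submodule.Quotient.eq _).2 ⟨⟨-a, K.neg_mem ha⟩, Subtype.ext ?_⟩
    simp
  exact DimLT.of_exact (hd.submodule _) (hd.submodule K) (LinearMap.exact_map_mkQ_range _)
    (Submodule.mkQ_surjective _) hK h1

theorem exists_smallPart [Module.Finite R M] (hd : IsIdealOfDefinition Q M) (r : ℕ) :
    ∃ P : Submodule R M, DimLT Q r P ∧ (∀ K : Submodule R M, DimLT Q r K → K ≤ P) ∧
      NoSmallSubmodule Q r (M ⧸ P) := by
  have hbot : DimLT Q r (⊥ : Submodule R M) := ⟨0, fun n => by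
    simp [hilbertSamuel, Module.length_eq_zero]⟩
  obtain ⟨P, hP, hmax⟩ := exists_maximal_ge_of_wellFoundedGT
    (fun K : Submodule R M => DimLT Q r K) ⊥ hbot |>.imp fun P h => h.2
  have hle : ∀ K : Submodule R M, DimLT Q r K → K ≤ P := fun K hK =>
    le_sup_right.trans (hmax (hP.sup hd hK) le_sup_left)
  refine ⟨P, hP, hle, fun K hK => ?_⟩
  have h1 : DimLT Q r (K.comap P.mkQ) := by
    refine DimLT.of_exact (hd.submodule _) (hd.submodule P)
      (f := Submodule.inclusion (by
        intro m hm
        rw [Submodule.mem_comap, show P.mkQ m = 0 from (Submodule.Quotient.mk_eq_zero _).2 hm]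
        exact K.zero_mem : P ≤ K.comap P.mkQ))
      (g := P.mkQ.restrict (p := K.comap P.mkQ) (q := K) fun m hm => hm) ?_ ?_ hP hK
    · rintro ⟨m, hm⟩
      constructor
      · intro h
        have : P.mkQ m = 0 := congrArg Subtype.val h
        exact ⟨⟨m, (Submodule.Quotient.mk_eq_zero _).1 this⟩, rfl⟩
      · rintro ⟨⟨p, hp⟩, h⟩
        have : p = m := congrArg Subtype.val h
        subst this
        exact Subtype.ext ((Submodule.Quotient.mk_eq_zero _).2 hp)
    · rintro ⟨k, hk⟩
      obtain ⟨m, rfl⟩ := Submodule.mkQ_surjective _ k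
      exact ⟨⟨m, hk⟩, rfl⟩
  rw [eq_bot_iff]
  intro k hk
  obtain ⟨m, rfl⟩ := Submodule.mkQ_surjective _ k
  exact (Submodule.Quotient.mk_eq_zero _).2 (hle _ h1 hk)

end Depth

section BaseChange

open scoped TensorProduct Pointwise

variable {R : Type*} [CommRing R] [IsLocalRing R] [IsNoetherianRing R]
  {S : Type*} [CommRing S] [IsLocalRing S] [IsNoetherianRing S] [Algebra R S]
  {M : Type*} [AddCommGroup M] [Module R M] {Q : Ideal R}

theorem hilbertSamuel_baseChange [Module.Flat R S] [IsLocalHom (algebraMap R S)]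
    (hm : (maximalIdeal R).map (algebraMap R S) = maximalIdeal S) (n : ℕ) :
    hilbertSamuel (Q.map (algebraMap R S)) (S ⊗[R] M) n = hilbertSamuel Q M n := by
  have h1 : Module.length S (S ⧸ (maximalIdeal R).map (algebraMap R S)) = 1 := by
    rw [hm, Module.length_eq_one_iff, isSimpleModule_iff_quot_maximal]
    exact ⟨_, inferInstance, ⟨LinearEquiv.refl _ _⟩⟩
  have h2 := IsLocalRing.length_baseChange R S (M ⧸ (Q ^ n • ⊤ : Submodule R M))
  rw [h1, mul_one] at h2
  unfold hilbertSamuel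
  rw [← h2, ← Ideal.map_pow]
  congr 1
  exact (TensorProduct.tensorQuotMapSMulEquivTensorQuot M S (Q ^ n)).length_eq

theorem IsIdealOfDefinition.baseChange (h : IsIdealOfDefinition Q M)
    (hm : (maximalIdeal R).map (algebraMap R S) = maximalIdeal S) :
    IsIdealOfDefinition (Q.map (algebraMap R S)) (S ⊗[R] M) := by
  obtain ⟨a, ha⟩ := h
  refine ⟨a, ?_⟩
  rw [← hm, ← Ideal.map_pow]
  refine (Ideal.map_mono ha).trans ?_
  rw [Ideal.map_sup]
  refine sup_le_sup_left ?_ _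
  rw [Ideal.map_le_iff_le_comap]
  intro c hc
  rw [Ideal.mem_comap, Module.mem_annihilator]
  intro z
  induction z with
  | zero => simp
  | add a b ha hb => rw [smul_add, ha, hb, add_zero]
  | tmul r m =>
    rw [algebraMap_smul, ← TensorProduct.tmul_smul, Module.mem_annihilator.1 hc m,
      TensorProduct.tmul_zero]

theorem HasDepthGE.baseChange [Module.Flat R S] [IsLocalHom (algebraMap R S)] {s : ℕ}
    (h : HasDepthGE R s M) : HasDepthGE S s (S ⊗[R] M) := by
  obtain ⟨rs, h1, h2, h3⟩ := h
  refine ⟨rs.map (algebraMap R S), ?_, ?_, by simpa using h3⟩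
  · simp only [List.mem_map]
    rintro _ ⟨x, hx, rfl⟩
    have := h1 x hx
    rw [mem_maximalIdeal, mem_nonunits_iff] at this ⊢
    rwa [isUnit_map_iff]
  · exact RingTheory.Sequence.IsWeaklyRegular.of_flat_of_isBaseChange
      (TensorProduct.isBaseChange R M S) h2

theorem HasDepthGE.of_baseChange [Module.Flat R S] [IsLocalHom (algebraMap R S)]
    (hm : (maximalIdeal R).map (algebraMap R S) = maximalIdeal S) : ∀ {s : ℕ} {M : Type*}
    [AddCommGroup M] [Module R M] [Module.Finite R M], HasDepthGE S s (S ⊗[R] M) →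
    HasDepthGE R s M := by
  have : Module.FaithfullyFlat R S := Module.FaithfullyFlat.of_flat_of_isLocalHom
  intro s
  induction s with
  | zero => intro M _ _ _ _; exact hasDepthGE_zero
  | succ s ih =>
    intro M _ _ _ h
    obtain ⟨y, hym, hy, -⟩ := hasDepthGE_succ.1 h
    obtain ⟨x, hxm, hx⟩ := exists_isSMulRegular_mem (M := M) (maximalIdeal R) (by
      intro u hu
      have h1 : (1 : S) ⊗ₜ[R] u = 0 := by
        apply hy
        change y • _ = y • (0 : S ⊗[R] M)
        rw [smul_zero]
        rw [← hm] at hym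
        clear hy
        induction hym using Submodule.span_induction with
        | zero => simp
        | add a b _ _ ha hb => rw [add_smul, ha, hb, add_zero]
        | smul a b _ hb => rw [smul_eq_mul, mul_smul, hb, smul_zero]
        | mem c hc =>
          obtain ⟨c, hc, rfl⟩ := hc
          rw [algebraMap_smul, ← TensorProduct.tmul_smul, hu c hc, TensorProduct.tmul_zero]
      exact Module.FaithfullyFlat.tensorProduct_mk_injective (A := R) (B := S) M
        (by simpa using h1))
    have hx' : algebraMap R S x ∈ maximalIdeal S := hm ▸ Ideal.mem_map_of_mem _ hxm
    have hreg : IsSMulRegular (S ⊗[R] M) (algebraMap R S x) := by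
      have h1 : RingTheory.Sequence.IsWeaklyRegular M [x] := by simpa using hx
      simpa using RingTheory.Sequence.IsWeaklyRegular.of_flat_of_isBaseChange (S := S)
        (TensorProduct.isBaseChange R M S) h1
    refine hasDepthGE_succ.2 ⟨x, hxm, hx, ih ?_⟩
    exact (h.quotSMulTop hx' hreg).congr
      (QuotSMulTop.algebraMapTensorEquivTensorQuotSMulTop x M S)

theorem hilbertSamuel_restrictScalars [IsLocalHom (algebraMap R S)] {K : Type*} [AddCommGroup K]
    [Module R K] [Module S K] [IsScalarTower R S K] (n : ℕ) :
    hilbertSamuel Q K n = hilbertSamuel (Q.map (algebraMap R S)) K n *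
      (Module.length (ResidueField R) (ResidueField S)).toNat := by
  have h := IsLocalRing.length_restrictScalars R S
    (K ⧸ (Q.map (algebraMap R S) ^ n • ⊤ : Submodule S K))
  unfold hilbertSamuel
  rw [← ENat.toNat_mul, ← h]
  congr 1
  have h2 : (Q.map (algebraMap R S) ^ n • ⊤ : Submodule S K).restrictScalars R = Q ^ n • ⊤ := by
    rw [← Ideal.map_pow, Ideal.smul_restrictScalars, Submodule.restrictScalars_top]
  rw [← h2]
  rfl

theorem eq_zero_of_forall_repr [Module.Free R S] (z : S ⊗[R] M)
    (h : ∀ φ : S ⊗[R] M →ₗ[R] M, φ z = 0) : z = 0 := by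
  let e := TensorProduct.equivFinsuppOfBasisLeft (N := M) (Module.Free.chooseBasis R S)
  apply e.injective
  rw [map_zero]
  ext i
  exact h (Finsupp.lapply i ∘ₗ e.toLinearMap)

theorem NoSmallSubmodule.baseChange [Module.Free R S] [Module.Finite R S] [Module.Finite R M]
    [IsLocalHom (algebraMap R S)] (hd : IsIdealOfDefinition Q M) {s : ℕ}
    (h : NoSmallSubmodule Q s M) :
    NoSmallSubmodule (Q.map (algebraMap R S)) s (S ⊗[R] M) := by
  intro K hK
  have h1 : DimLT Q s K := by
    obtain ⟨C, hC⟩ := hK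
    refine ⟨C * (Module.length (ResidueField R) (ResidueField S)).toNat, fun n => ?_⟩
    have := hC n
    rw [Nat.abs_cast] at this ⊢
    rw [hilbertSamuel_restrictScalars (S := S)]
    push_cast
    calc _ = _ * ((n : ℤ) + 1) * ((Module.length (ResidueField R) (ResidueField S)).toNat : ℤ) := by
            ring
      _ ≤ _ := mul_le_mul_of_nonneg_right this (by positivity)
      _ = _ := by ring
  have hd2 : IsIdealOfDefinition Q (S ⊗[R] M) := by
    obtain ⟨a, ha⟩ := hd
    refine ⟨a, ha.trans (sup_le_sup_left ?_ _)⟩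
    intro c hc
    rw [Module.mem_annihilator]
    intro z
    induction z with
    | zero => simp
    | add a b ha hb => rw [smul_add, ha, hb, add_zero]
    | tmul r m => rw [← TensorProduct.tmul_smul, Module.mem_annihilator.1 hc m,
        TensorProduct.tmul_zero]
  have hd3 : IsIdealOfDefinition Q (K.restrictScalars R) := hd2.submodule _
  replace h1 : DimLT Q s (K.restrictScalars R) := h1
  rw [eq_bot_iff]
  intro z hz
  refine eq_zero_of_forall_repr z fun φ => ?_
  have h2 := h (LinearMap.range (φ ∘ₗ (K.restrictScalars R).subtype))
    (DimLT.of_surjective (M := K.restrictScalars R) hd3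
      (φ ∘ₗ (K.restrictScalars R).subtype).rangeRestrict
      (LinearMap.surjective_rangeRestrict _) h1)
  rw [LinearMap.range_eq_bot] at h2
  exact LinearMap.congr_fun h2 ⟨z, hz⟩

/-- Descending chains of submodules with zero intersection are cofinal with the adic topology. -/
def IsChevalley.{v} (R : Type*) [CommRing R] [IsLocalRing R] : Prop :=
  ∀ (M : Type v) [AddCommGroup M] [Module R M] [Module.Finite R M] (V : ℕ → Submodule R M),
    Antitone V → ⨅ n, V n = ⊥ → ∀ n, ∃ k, V k ≤ maximalIdeal R ^ n • ⊤

theorem IsChevalley.of_finite.{v} [Module.Finite R S]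
    (hm : (maximalIdeal R).map (algebraMap R S) = maximalIdeal S) (h : IsChevalley.{v} R) :
    IsChevalley.{v} S := by
  intro M _ _ _ V hV hV0 n
  letI : Module R M := Module.compHom M (algebraMap R S)
  haveI : IsScalarTower R S M := ⟨fun r s m => by
    rw [Algebra.smul_def, mul_smul]; rfl⟩
  haveI : Module.Finite R M := Module.Finite.trans S M
  obtain ⟨k, hk⟩ := h M (fun n => (V n).restrictScalars R) (fun a b hab => hV hab) (by
    rw [eq_bot_iff] at hV0 ⊢
    intro z hz
    rw [Submodule.mem_iInf] at hz
    exact hV0 ((Submodule.mem_iInf _).2 hz)) n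
  refine ⟨k, fun z hz => ?_⟩
  have h2 := hk hz
  rw [← Submodule.restrictScalars_top R S M, ← Ideal.smul_restrictScalars, Ideal.map_pow, hm] at h2
  exact h2

end BaseChange

section SuperficialElements

open scoped Pointwise

theorem exists_forall_succ_eq_smul {A N : Type*} [CommRing A] [IsNoetherianRing A] [AddCommGroup N]
    [Module A N] [Module.Finite A N] (I : Ideal A) (D : ℕ → Submodule A N)
    (h1 : ∀ n, D n ≤ I ^ n • ⊤) (h2 : ∀ n, D (n + 1) ≤ D n) (h3 : ∀ n, I • D n ≤ D (n + 1)) :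
    ∃ n₀, ∀ n ≥ n₀, D (n + 1) = I • D n := by
  let F : I.Filtration N := ⟨D, h2, h3⟩
  have : F.Stable := (I.stableFiltration_stable (⊤ : Submodule A N)).of_le (F' := F) fun n => h1 n
  obtain ⟨n₀, h⟩ := this
  exact ⟨n₀, fun n hn => (h n hn).symm⟩

/-- The elements of `I ^ n • N` that `I ^ k` multiplies into `I ^ (n + k + 1) • N`. -/
def powColon {A : Type*} (N : Type*) [CommRing A] [AddCommGroup N] [Module A N] (I : Ideal A)
    (n k : ℕ) : Submodule A N where
  carrier := {u | u ∈ (I ^ n • ⊤ : Submodule A N) ∧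
    ∀ q ∈ I ^ k, q • u ∈ (I ^ (n + k + 1) • ⊤ : Submodule A N)}
  zero_mem' := ⟨Submodule.zero_mem _, fun q _ => by simp⟩
  add_mem' ha hb := ⟨Submodule.add_mem _ ha.1 hb.1, fun q hq => by
    rw [smul_add]; exact Submodule.add_mem _ (ha.2 q hq) (hb.2 q hq)⟩
  smul_mem' r u hu := ⟨Submodule.smul_mem _ _ hu.1, fun q hq => by
    rw [smul_comm]; exact Submodule.smul_mem _ _ (hu.2 q hq)⟩

theorem monotone_powColon {A : Type*} (N : Type*) [CommRing A] [AddCommGroup N] [Module A N]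
    (I : Ideal A) (n : ℕ) : Monotone (powColon N I n) := by
  refine monotone_nat_of_le_succ fun k u hu => ⟨hu.1, fun q hq => ?_⟩
  rw [pow_succ'] at hq
  induction hq using Submodule.mul_induction_on' with
  | mem_mul_mem a ha b hb =>
    rw [mul_smul, ← add_assoc, pow_succ', Submodule.mul_smul]
    exact Submodule.smul_mem_smul ha (hu.2 b hb)
  | add a _ b _ ha hb => rw [add_smul]; exact Submodule.add_mem _ ha hb

theorem mem_iSup_powColon {A N : Type*} [CommRing A] [AddCommGroup N] [Module A N] (I : Ideal A)
    (n : ℕ) (u : N) : u ∈ ⨆ k, powColon N I n k ↔ ∃ k, u ∈ powColon N I n k :=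
  Submodule.mem_iSup_of_directed _ (monotone_powColon N I n).directed_le

theorem exists_forall_iSup_powColon_succ {A : Type*} (N : Type*) [CommRing A] [IsNoetherianRing A]
    [AddCommGroup N] [Module A N] [Module.Finite A N] (I : Ideal A) :
    ∃ n₀, ∀ n ≥ n₀, ⨆ k, powColon N I (n + 1) k = I • ⨆ k, powColon N I n k := by
  refine exists_forall_succ_eq_smul I (fun n => ⨆ k, powColon N I n k)
    (fun n => iSup_le fun k u hu => hu.1) (fun n => iSup_le fun k u hu => ?_) fun n => ?_
  · have h1 : u ∈ (I ^ (n + 1) • ⊤ : Submodule A N) := hu.1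
    refine (mem_iSup_powColon I n u).2 ⟨0, ?_, fun q _ => Submodule.smul_mem _ _ h1⟩
    exact Submodule.smul_mono_left (Ideal.pow_le_pow_right (by omega)) h1
  · rw [Submodule.smul_le]
    intro q hq u hu
    obtain ⟨k, hk⟩ := (mem_iSup_powColon I n u).1 hu
    refine (mem_iSup_powColon I (n + 1) _).2 ⟨k, ?_, fun r hr => ?_⟩
    · rw [pow_succ', Submodule.mul_smul]
      exact Submodule.smul_mem_smul hq hk.1
    · rw [smul_comm, show n + 1 + k + 1 = (n + k + 1) + 1 by ring, pow_succ', Submodule.mul_smul]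
      exact Submodule.smul_mem_smul hq (hk.2 r hr)

theorem exists_iSup_powColon_le {A : Type*} (N : Type*) [CommRing A]
    [AddCommGroup N] [Module A N] [IsNoetherian A N] (I : Ideal A) (n : ℕ) :
    ∃ k, ⨆ j, powColon N I n j ≤ powColon N I n k := by
  obtain ⟨k, hk⟩ := monotone_stabilizes_iff_noetherian.2 ‹IsNoetherian A N›
    ⟨powColon N I n, monotone_powColon N I n⟩
  refine ⟨k, iSup_le fun j => ?_⟩
  rcases le_total j k with h | h
  · exact monotone_powColon N I n h
  · exact (hk j h).ge

theorem exists_forall_mem_pow_succ_smul {A N : Type*} [CommRing A] [IsNoetherianRing A]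
    [AddCommGroup N] [Module A N] [Module.Finite A N] (I : Ideal A) :
    ∃ n₀, ∀ n ≥ n₀, ∀ u ∈ (I ^ n • ⊤ : Submodule A N),
      (∀ q ∈ I, q • u ∈ (I ^ (n + 2) • ⊤ : Submodule A N)) →
      u ∈ (I ^ (n + 1) • ⊤ : Submodule A N) := by
  obtain ⟨n₀, hn₀⟩ := exists_forall_iSup_powColon_succ N I
  obtain ⟨k, hk⟩ := exists_iSup_powColon_le N I n₀
  have hpow : ∀ j, ⨆ k, powColon N I (n₀ + j) k = I ^ j • ⨆ k, powColon N I n₀ k := by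
    intro j
    induction j with
    | zero => rw [pow_zero, Ideal.one_eq_top, Submodule.top_smul, add_zero]
    | succ j ih =>
      rw [← add_assoc, hn₀ (n₀ + j) (Nat.le_add_right _ _), ih, pow_succ', Submodule.mul_smul]
  refine ⟨n₀ + k, fun n hn u hu h => ?_⟩
  obtain ⟨j, rfl⟩ := Nat.exists_eq_add_of_le hn
  have h1 : u ∈ I ^ j • (I ^ k • ⨆ k, powColon N I n₀ k) := by
    rw [← Submodule.mul_smul, ← pow_add, ← hpow]
    refine (mem_iSup_powColon I _ _).2 ⟨1, ?_, fun q hq => ?_⟩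
    · rwa [← add_assoc, add_right_comm]
    · rw [show n₀ + (j + k) + 1 + 1 = n₀ + k + j + 2 by ring]
      exact h q (by rwa [pow_one] at hq)
  have h2 : I ^ k • ⨆ k, powColon N I n₀ k ≤ I ^ (n₀ + k + 1) • ⊤ :=
    Submodule.smul_le.2 fun q hq v hv => (hk hv).2 q hq
  have h3 := Submodule.smul_mono (le_refl (I ^ j)) h2 h1
  rwa [← Submodule.mul_smul, ← pow_add, show j + (n₀ + k + 1) = n₀ + k + j + 1 by ring] at h3

/-- A form of McCoy's theorem for filtered modules. -/
theorem forall_mem_succ_of_convolution {A N : Type*} [CommRing A] [AddCommGroup N] [Module A N]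
    {c : ℕ → A} {s : ℕ} (hc : ∀ i ≥ s, c i = 0) {F : ℕ → Submodule A N}
    (hF : ∀ i n, ∀ u ∈ F n, c i • u ∈ F (n + 1)) {n₀ : ℕ}
    (h : ∀ n ≥ n₀, ∀ u ∈ F n, (∀ i, c i • u ∈ F (n + 2)) → u ∈ F (n + 1)) (d : ℕ) :
    ∀ n ≥ n₀, ∀ g : ℕ → N, (∀ j, g j ∈ F n) → (∀ j ≥ d, g j = 0) →
      (∀ l, ∑ p ∈ antidiagonal l, c p.1 • g p.2 ∈ F (n + 2)) → ∀ j, g j ∈ F (n + 1) := by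
  induction d with
  | zero => intro n _ g _ hg _ j; rw [hg j (by omega)]; exact Submodule.zero_mem _
  | succ d ih =>
    intro n hn g hgF hg hcg j
    suffices key : ∀ k i, s ≤ i + k → ∀ j, c i • g j ∈ F (n + 2) from
      h n hn _ (hgF j) fun i => key s i (by omega) j
    intro k
    induction k with
    | zero =>
      intro i hi j
      rw [hc i (by omega), zero_smul]; exact Submodule.zero_mem _
    | succ k ihk =>
      intro i hi
      have htop : c i • g d ∈ F (n + 2) := by
        have h1 := hcg (i + d)
        rw [← Finset.add_sum_erase _ _ (a := (i, d)) (by simp)] at h1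
        refine (Submodule.add_mem_iff_left _ (Submodule.sum_mem _ ?_)).1 h1
        rintro ⟨a, b⟩ hab
        simp only [mem_erase, HasAntidiagonal.mem_antidiagonal, ne_eq, Prod.mk.injEq] at hab
        rcases lt_or_ge i a with hia | hia
        · exact ihk a (by omega) b
        · rw [hg b (by omega), smul_zero]; exact Submodule.zero_mem _
      have h2 := ih (n + 1) (by omega) (fun j => if j = d then 0 else c i • g j)
        (fun j => by
          split_ifs
          exacts [Submodule.zero_mem _, hF i n _ (hgF j)])
        (fun j hj => by
          split_ifs with hjd
          · rfl
          · rw [hg j (by omega), smul_zero])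
        (fun l => by
          have h3 : ∑ p ∈ antidiagonal l, c p.1 • (if p.2 = d then 0 else c i • g p.2) =
              c i • ∑ p ∈ antidiagonal l, c p.1 • g p.2 -
              ∑ p ∈ antidiagonal l, if p.2 = d then c p.1 • c i • g d else 0 := by
            rw [Finset.smul_sum, ← Finset.sum_sub_distrib]
            refine Finset.sum_congr rfl fun p _ => ?_
            split_ifs with hp
            · rw [hp, smul_comm (c i), smul_zero, sub_self]
            · rw [smul_comm (c i), sub_zero]
          rw [h3]
          refine Submodule.sub_mem _ (hF i _ _ (hcg l)) (Submodule.sum_mem _ fun p _ => ?_)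
          split_ifs
          exacts [hF _ _ _ htop, Submodule.zero_mem _])
      intro j
      have h4 := h2 j
      split_ifs at h4 with hjd
      · rwa [hjd]
      · exact h4

theorem forall_mem_of_monic_convolution {A N : Type*} [CommRing A] [AddCommGroup N] [Module A N]
    {f : Polynomial A} (hf : f.Monic) {F : Submodule A N} {b : ℕ → N} {B : ℕ}
    (hb : ∀ j ≥ B, b j = 0)
    (h : ∀ l, ∑ p ∈ antidiagonal l, f.coeff p.1 • b p.2 ∈ F) (j : ℕ) : b j ∈ F := by
  suffices key : ∀ k j, B ≤ j + k → b j ∈ F from key B j (by omega)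
  intro k
  induction k with
  | zero => intro j hj; rw [hb j (by omega)]; exact F.zero_mem
  | succ k ih =>
    intro j hj
    have h1 := h (f.natDegree + j)
    rw [← Finset.add_sum_erase _ _ (a := (f.natDegree, j)) (by simp), hf.coeff_natDegree,
      one_smul] at h1
    refine (Submodule.add_mem_iff_left _ (Submodule.sum_mem _ ?_)).1 h1
    rintro ⟨a, b'⟩ hab
    simp only [mem_erase, HasAntidiagonal.mem_antidiagonal, ne_eq, Prod.mk.injEq] at hab
    rcases lt_or_ge j b' with hj' | hj'
    · exact F.smul_mem _ (ih b' (by omega))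
    · rw [Polynomial.coeff_eq_zero_of_natDegree_lt (by omega), zero_smul]; exact F.zero_mem

variable {R : Type*} [CommRing R] [IsLocalRing R] [IsNoetherianRing R]
  {M : Type*} [AddCommGroup M] [Module R M] {Q : Ideal R}

/-- `Q ^ k u = 0` implies `u = 0`. -/
def IsTorsionFreeFor (Q : Ideal R) (M : Type*) [AddCommGroup M] [Module R M] : Prop :=
  ∀ (k : ℕ) (u : M), (∀ q ∈ Q ^ k, q • u = 0) → u = 0

theorem hilbertSamuel_quotSMulTop_of_superficial [Module.Finite R M] (hQ : Q ≤ maximalIdeal R)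
    (hd : IsIdealOfDefinition Q M) (hM : IsTorsionFreeFor Q M) {c : R} (hc : c ∈ Q) {n₁ : ℕ}
    (h : ∀ n ≥ n₁, ∀ u ∈ (Q ^ n • ⊤ : Submodule R M), c • u ∈ (Q ^ (n + 2) • ⊤ : Submodule R M) →
      u ∈ (Q ^ (n + 1) • ⊤ : Submodule R M)) :
    IsSMulRegular M c ∧ ∃ N, ∀ n ≥ N, hilbertSamuel Q M (n + 1) =
      hilbertSamuel Q (QuotSMulTop c M) (n + 1) + hilbertSamuel Q M n := by
  have hstep : ∀ j n, n₁ ≤ n → ∀ u ∈ (Q ^ n • ⊤ : Submodule R M),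
      c • u ∈ (Q ^ (n + j + 1) • ⊤ : Submodule R M) →
      u ∈ (Q ^ (n + j) • ⊤ : Submodule R M) := by
    intro j
    induction j with
    | zero => intro n _ u hu _; exact hu
    | succ j ih =>
      intro n hn u hu hcu
      have := ih (n + 1) (by omega) u (h n hn u hu (Submodule.smul_mono_left
        (Ideal.pow_le_pow_right (by omega)) hcu)) (by rwa [show n + 1 + j + 1 = n + (j + 1) + 1 by ring])
      rwa [show n + (j + 1) = n + 1 + j by ring]
  have hzero : ∀ u ∈ (Q ^ n₁ • ⊤ : Submodule R M), c • u = 0 → u = 0 := by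
    intro u hu hcu
    have h1 : u ∈ ⨅ n : ℕ, (Q ^ n • ⊤ : Submodule R M) := by
      rw [Submodule.mem_iInf]
      intro n
      have := hstep n n₁ le_rfl u hu (by rw [hcu]; exact Submodule.zero_mem _)
      exact Submodule.smul_mono_left (Ideal.pow_le_pow_right (by omega)) this
    rwa [Ideal.iInf_pow_smul_eq_bot_of_isLocalRing Q (ne_top_of_le_ne_top
      (maximalIdeal.isMaximal R).ne_top hQ)] at h1
  have hreg : IsSMulRegular M c := by
    refine isSMulRegular_iff_right_eq_zero_of_smul.2 fun u hu => ?_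
    refine hM n₁ u fun q hq => hzero _ (Submodule.smul_mem_smul hq trivial) ?_
    rw [smul_comm, hu, smul_zero]
  refine ⟨hreg, ?_⟩
  obtain ⟨k, hk⟩ := exists_forall_comap_le Q (LinearMap.lsmul R M c) hreg
  refine ⟨n₁ + k, fun n hn => ?_⟩
  rw [hilbertSamuel_eq_add hd (exact_lsmul_mkQ c M) (Submodule.mkQ_surjective _) (n + 1)]
  congr 1
  have hcomap : (Q ^ (n + 1) • ⊤ : Submodule R M).comap (LinearMap.lsmul R M c) = Q ^ n • ⊤ := by
    apply le_antisymm
    · intro u hu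
      have h1 := hk (n + 1 - k) (by rwa [Nat.sub_add_cancel (by omega)])
      have h2 := hstep (n - (n + 1 - k)) (n + 1 - k) (by omega) u h1
      rcases Nat.eq_zero_or_pos k with rfl | hk0
      · exact Submodule.smul_mono_left (Ideal.pow_le_pow_right (by omega)) h1
      · rw [show n + 1 - k + (n - (n + 1 - k)) = n by omega] at h2
        exact h2 hu
    · intro m hm
      rw [Submodule.mem_comap, pow_succ', Submodule.mul_smul]
      exact Submodule.smul_mem_smul hc hm
  unfold imageLength hilbertSamuel
  rw [hcomap]

end SuperficialElements

section PolynomialExtension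

open Polynomial

theorem PolynomialModule.mem_map_C_smul_top_iff {R M : Type*} [CommRing R] [AddCommGroup M]
    [Module R M] (I : Ideal R) (g : PolynomialModule R M) :
    g ∈ (I.map (C : R →+* R[X]) • ⊤ : Submodule R[X] (PolynomialModule R M)) ↔
      ∀ j, g.coeff j ∈ (I • ⊤ : Submodule R M) := by
  constructor
  · intro hg
    induction hg using Submodule.smul_induction_on' with
    | smul p hp z _ =>
      intro j
      rw [PolynomialModule.smul_apply]
      exact Submodule.sum_mem _ fun x _ => Submodule.smul_mem_smul (Ideal.mem_map_C_iff.1 hp _) trivial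
    | add x _ y _ hx hy =>
      intro j
      simpa using Submodule.add_mem _ (hx j) (hy j)
  · intro hg
    have h1 : ∀ j, ∀ u ∈ (I • ⊤ : Submodule R M), PolynomialModule.single R j u ∈
        (I.map (C : R →+* R[X]) • ⊤ : Submodule R[X] (PolynomialModule R M)) := by
      intro j u hu
      induction hu using Submodule.smul_induction_on' with
      | smul r hr m _ =>
        have : PolynomialModule.single R j (r • m) = C r • PolynomialModule.single R j m := by
          rw [← monomial_zero_left, PolynomialModule.monomial_smul_single, zero_add]
        rw [this]
        exact Submodule.smul_mem_smul (Ideal.mem_map_of_mem _ hr) trivial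
      | add x _ y _ hx hy => rw [PolynomialModule.single_add]; exact Submodule.add_mem _ hx hy
    have h2 : g = ∑ j ∈ g.coeff.support, PolynomialModule.single R j (g.coeff j) := by
      apply (PolynomialModule.coeffLinearEquiv (R := R) (M := M) (S := R)).injective
      rw [map_sum]
      exact (Finsupp.sum_single g.coeff).symm
    rw [h2]
    exact Submodule.sum_mem _ fun j _ => h1 j _ (hg j)

theorem exists_forall_smul_mem_of_fg {A N : Type*} [CommRing A] [AddCommGroup N] [Module A N]
    (S : Submonoid A) (E : Submodule A N) {D : Submodule A N} (hD : D.FG)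
    (h : ∀ u ∈ D, ∃ f ∈ S, f • u ∈ E) : ∃ f ∈ S, ∀ u ∈ D, f • u ∈ E := by
  classical
  induction D, hD using Submodule.fg_induction with
  | singleton x =>
    obtain ⟨f, hf, hfx⟩ := h x (Submodule.mem_span_singleton_self x)
    refine ⟨f, hf, fun u hu => ?_⟩
    obtain ⟨r, rfl⟩ := Submodule.mem_span_singleton.1 hu
    rw [smul_comm]
    exact E.smul_mem _ hfx
  | sup D₁ D₂ _ _ h₁ h₂ =>
    obtain ⟨f, hf, hf'⟩ := h₁ fun u hu => h u (Submodule.mem_sup_left hu)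
    obtain ⟨g, hg, hg'⟩ := h₂ fun u hu => h u (Submodule.mem_sup_right hu)
    refine ⟨f * g, S.mul_mem hf hg, fun u hu => ?_⟩
    obtain ⟨a, ha, b, hb, rfl⟩ := Submodule.mem_sup.1 hu
    rw [smul_add]
    refine E.add_mem ?_ ?_
    · rw [mul_comm, mul_smul]; exact E.smul_mem _ (hf' a ha)
    · rw [mul_smul]; exact E.smul_mem _ (hg' b hb)

theorem Polynomial.exists_monic_irreducible_isCoprime {k : Type*} [Field k] {p : k[X]}
    (hp : p ≠ 0) : ∃ g : k[X], g.Monic ∧ Irreducible g ∧ IsCoprime g p := by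
  have hdeg : (X * p + 1).natDegree = p.natDegree + 1 := by
    rw [← C_1, natDegree_add_C, natDegree_X_mul hp]
  have h0 : X * p + 1 ≠ 0 := fun h => by simp [h] at hdeg
  obtain ⟨q, hq, hqd⟩ := WfDvdMonoid.exists_irreducible_factor
    (fun h => by simp [natDegree_eq_zero_of_isUnit h] at hdeg) h0
  refine ⟨q * C q.leadingCoeff⁻¹, monic_mul_leadingCoeff_inv hq.ne_zero,
    irreducible_mul_leadingCoeff_inv.2 hq, ?_⟩
  have hu : IsUnit (C q.leadingCoeff⁻¹) := by
    rw [isUnit_C]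
    exact (inv_ne_zero (leadingCoeff_ne_zero.2 hq.ne_zero)).isUnit
  refine (isCoprime_mul_unit_right_left hu q p).2 ?_
  obtain ⟨r, hr⟩ := hqd
  exact ⟨r, -X, by linear_combination -hr⟩

variable {R : Type*} [CommRing R] [IsLocalRing R] [IsNoetherianRing R]
  {M : Type*} [AddCommGroup M] [Module R M] {Q : Ideal R}

instance [Module.Finite R M] : Module.Finite R[X] (PolynomialModule R M) :=
  Module.Finite.equiv (PolynomialModule.polynomialTensorProductLEquivPolynomialModule R M)

theorem smul_mem_pow_succ_smul_of_mem_sup_annihilator {r : R} (hr : r ∈ Q ⊔ Module.annihilator R M)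
    {n : ℕ} {u : M} (hu : u ∈ (Q ^ n • ⊤ : Submodule R M)) :
    r • u ∈ (Q ^ (n + 1) • ⊤ : Submodule R M) := by
  obtain ⟨q, hq, z, hz, rfl⟩ := Submodule.mem_sup.1 hr
  rw [add_smul, Module.mem_annihilator.1 hz, add_zero, pow_succ', Submodule.mul_smul]
  exact Submodule.smul_mem_smul hq hu

theorem PolynomialModule.exists_forall_mem_pow_succ_smul [Module.Finite R M] {c : R[X]}
    (hc : Q = Ideal.span (Set.range c.coeff)) :
    ∃ n₀, ∀ n ≥ n₀, ∀ g ∈ ((Q ^ n).map C • ⊤ : Submodule R[X] (PolynomialModule R M)),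
      c • g ∈ ((Q ^ (n + 2)).map C • ⊤ : Submodule R[X] (PolynomialModule R M)) →
      g ∈ ((Q ^ (n + 1)).map C • ⊤ : Submodule R[X] (PolynomialModule R M)) := by
  have hcQ : ∀ i, c.coeff i ∈ Q := fun i => by rw [hc]; exact Ideal.subset_span ⟨i, rfl⟩
  obtain ⟨n₀, h⟩ := _root_.exists_forall_mem_pow_succ_smul (N := M) Q
  refine ⟨n₀, fun n hn g hg hcg => ?_⟩
  rw [mem_map_C_smul_top_iff] at hg hcg ⊢
  refine forall_mem_succ_of_convolution (c := c.coeff) (s := c.natDegree + 1)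
    (F := fun n => (Q ^ n • ⊤ : Submodule R M))
    (fun i hi => coeff_eq_zero_of_natDegree_lt (by omega)) (fun i n u hu => ?_) (n₀ := n₀)
    (fun n hn u hu hcu => h n hn u hu fun q hq => ?_) (g.coeff.support.sup id + 1) n hn g.coeff hg
    (fun j hj => ?_) (fun l => ?_)
  · rw [pow_succ', Submodule.mul_smul]
    exact Submodule.smul_mem_smul (hcQ i) hu
  · rw [hc] at hq
    induction hq using Submodule.span_induction with
    | mem x hx => obtain ⟨i, rfl⟩ := hx; exact hcu i
    | zero => rw [zero_smul]; exact Submodule.zero_mem _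
    | add x y _ _ hx hy => rw [add_smul]; exact Submodule.add_mem _ hx hy
    | smul a x _ hx => rw [smul_assoc]; exact Submodule.smul_mem _ _ hx
  · by_contra hne
    have := Finset.le_sup (f := id) (Finsupp.mem_support_iff.2 hne)
    simp only [id] at this
    omega
  · have := hcg l
    rwa [PolynomialModule.smul_apply] at this

theorem PolynomialModule.mem_of_monic_smul_mem {f : R[X]} (hf : f.Monic) {I : Ideal R}
    {b : PolynomialModule R M}
    (h : f • b ∈ (I.map C • ⊤ : Submodule R[X] (PolynomialModule R M))) :
    b ∈ (I.map C • ⊤ : Submodule R[X] (PolynomialModule R M)) := by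
  rw [mem_map_C_smul_top_iff] at h ⊢
  refine fun j => forall_mem_of_monic_convolution hf (b := b.coeff)
    (B := b.coeff.support.sup id + 1) (fun j hj => ?_) (fun l => ?_) j
  · by_contra hne
    have := Finset.le_sup (f := id) (Finsupp.mem_support_iff.2 hne)
    simp only [id] at this
    omega
  · have := h l
    rwa [PolynomialModule.smul_apply] at this

/-- The submodule `c Q ^ n M[X] + Q ^ (n + 2) M[X]` of `M[X]`. -/
noncomputable def superficialImage (M : Type*) [AddCommGroup M] [Module R M] (Q : Ideal R)
    (c : R[X]) (n : ℕ) : Submodule R[X] (PolynomialModule R M) :=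
  ((Q ^ n).map C • ⊤ : Submodule R[X] (PolynomialModule R M)).map
    (LinearMap.lsmul R[X] (PolynomialModule R M) c) ⊔ (Q ^ (n + 2)).map C • ⊤

theorem mem_superficialImage {c : R[X]} {n : ℕ} {h : PolynomialModule R M} :
    h ∈ superficialImage M Q c n ↔
      ∃ g ∈ ((Q ^ n).map C • ⊤ : Submodule R[X] (PolynomialModule R M)),
        h - c • g ∈ ((Q ^ (n + 2)).map C • ⊤ : Submodule R[X] (PolynomialModule R M)) := by
  constructor
  · intro hh
    obtain ⟨_, ⟨g, hg, rfl⟩, b, hb, rfl⟩ := Submodule.mem_sup.1 hh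
    exact ⟨g, hg, by simpa using hb⟩
  · rintro ⟨g, hg, hb⟩
    exact Submodule.mem_sup.2 ⟨_, ⟨g, hg, rfl⟩, _, hb, by simp⟩

theorem map_C_pow_smul_mono {m n : ℕ} (h : m ≤ n) :
    ((Q ^ n).map C • ⊤ : Submodule R[X] (PolynomialModule R M)) ≤ (Q ^ m).map C • ⊤ :=
  Submodule.smul_mono_left (Ideal.map_mono (Ideal.pow_le_pow_right h))

theorem smul_mem_map_C_pow_succ {q : R[X]} (hq : q ∈ Q.map C) {n : ℕ} {g : PolynomialModule R M}
    (hg : g ∈ ((Q ^ n).map C • ⊤ : Submodule R[X] (PolynomialModule R M))) :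
    q • g ∈ ((Q ^ (n + 1)).map C • ⊤ : Submodule R[X] (PolynomialModule R M)) := by
  rw [pow_succ', Ideal.map_mul, Submodule.mul_smul]
  exact Submodule.smul_mem_smul hq hg

theorem smul_superficialImage_le (c : R[X]) (n : ℕ) :
    Q.map C • superficialImage M Q c n ≤ superficialImage M Q c (n + 1) := by
  rw [Submodule.smul_le]
  intro q hq h hh
  obtain ⟨g, hg, hb⟩ := mem_superficialImage.1 hh
  refine mem_superficialImage.2 ⟨q • g, smul_mem_map_C_pow_succ hq hg, ?_⟩
  rw [smul_comm, ← smul_sub]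
  exact smul_mem_map_C_pow_succ hq hb

theorem superficialImage_succ_le (c : R[X]) (n : ℕ) :
    superficialImage M Q c (n + 1) ≤ superficialImage M Q c n := by
  intro h hh
  obtain ⟨g, hg, hb⟩ := mem_superficialImage.1 hh
  exact mem_superficialImage.2 ⟨g, map_C_pow_smul_mono (by omega) hg,
    map_C_pow_smul_mono (by omega) hb⟩

/-- The polynomials with nonzero image over the residue field. -/
noncomputable def nonzeroModMaximal (R : Type*) [CommRing R] [IsLocalRing R] : Submonoid R[X] :=
  (nonZeroDivisors (ResidueField R)[X]).comap (mapRingHom (residue R))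

theorem mem_nonzeroModMaximal {f : R[X]} : f ∈ nonzeroModMaximal R ↔ f.map (residue R) ≠ 0 := by
  rw [nonzeroModMaximal, Submonoid.mem_comap, mem_nonZeroDivisors_iff_ne_zero, coe_mapRingHom]

theorem exists_nonzeroModMaximal_smul_mem [Module.Finite R M] (Q : Ideal R) (c : R[X]) :
    ∃ f₀ ∈ nonzeroModMaximal R, ∃ n₁, ∀ n ≥ n₁,
      ∀ h ∈ ((Q ^ (n + 1)).map C • ⊤ : Submodule R[X] (PolynomialModule R M)),
      (∃ f ∈ nonzeroModMaximal R, f • h ∈ superficialImage M Q c n) →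
      f₀ • h ∈ superficialImage M Q c n := by
  let D : ℕ → Submodule R[X] (PolynomialModule R M) := fun n =>
    { carrier := {h | h ∈ ((Q ^ (n + 1)).map C • ⊤ : Submodule R[X] (PolynomialModule R M)) ∧
        ∃ f ∈ nonzeroModMaximal R, f • h ∈ superficialImage M Q c n}
      zero_mem' := ⟨Submodule.zero_mem _, 1, one_mem _, by simp⟩
      add_mem' := by
        rintro a b ⟨ha, f, hf, hfa⟩ ⟨hb, g, hg, hgb⟩
        refine ⟨Submodule.add_mem _ ha hb, f * g, mul_mem hf hg, ?_⟩
        rw [smul_add]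
        refine Submodule.add_mem _ ?_ ?_
        · rw [mul_comm, mul_smul]; exact Submodule.smul_mem _ _ hfa
        · rw [mul_smul]; exact Submodule.smul_mem _ _ hgb
      smul_mem' := by
        rintro r a ⟨ha, f, hf, hfa⟩
        refine ⟨Submodule.smul_mem _ _ ha, f, hf, ?_⟩
        rw [smul_comm]
        exact Submodule.smul_mem _ _ hfa }
  obtain ⟨n₁, hn₁⟩ := exists_forall_succ_eq_smul (Q.map C) D
    (fun n h hh => by rw [← Ideal.map_pow]; exact map_C_pow_smul_mono (by omega) hh.1)
    (fun n h hh => by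
      obtain ⟨hh, f, hf, hfh⟩ := hh
      exact ⟨map_C_pow_smul_mono (by omega) hh, f, hf, superficialImage_succ_le c n hfh⟩)
    (fun n => by
      rw [Submodule.smul_le]
      rintro q hq h ⟨hh, f, hf, hfh⟩
      refine ⟨smul_mem_map_C_pow_succ hq hh, f, hf, ?_⟩
      rw [smul_comm]
      exact smul_superficialImage_le c n (Submodule.smul_mem_smul hq hfh))
  obtain ⟨f₀, hf₀, h₀⟩ := exists_forall_smul_mem_of_fg (nonzeroModMaximal R)
    (superficialImage M Q c n₁) (D := D n₁) (IsNoetherian.noetherian _) fun u hu => hu.2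
  suffices key : ∀ n ≥ n₁, ∀ h ∈ D n, f₀ • h ∈ superficialImage M Q c n from
    ⟨f₀, hf₀, n₁, fun n hn h hh hf => key n hn h ⟨hh, hf⟩⟩
  intro n hn
  induction n, hn using Nat.le_induction with
  | base => exact h₀
  | succ n hn ih =>
    intro h hh
    rw [hn₁ n hn] at hh
    induction hh using Submodule.smul_induction_on' with
    | smul q hq u hu =>
      rw [smul_comm]
      exact smul_superficialImage_le c n (Submodule.smul_mem_smul hq (ih u hu))
    | add x _ y _ hx hy => rw [smul_add]; exact Submodule.add_mem _ hx hy

/-- A monic polynomial, irreducible over the residue field, modulo which the polynomial `c` whose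
coefficients generate `Q` becomes superficial. -/
theorem exists_monic_superficial [Module.Finite R M] (hd : IsIdealOfDefinition Q M) {c : R[X]}
    (hc : Q = Ideal.span (Set.range c.coeff)) :
    ∃ f : R[X], f.Monic ∧ Irreducible (f.map (residue R)) ∧ ∃ n₁, ∀ n ≥ n₁,
      ∀ g ∈ ((Q ^ n).map C • ⊤ : Submodule R[X] (PolynomialModule R M)), ∀ b,
      c • g - f • b ∈ ((Q ^ (n + 2)).map C • ⊤ : Submodule R[X] (PolynomialModule R M)) →
      ∃ g', g - f • g' ∈ ((Q ^ (n + 1)).map C • ⊤ : Submodule R[X] (PolynomialModule R M)) := by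
  obtain ⟨f₀, hf₀, n₁, h₁⟩ := exists_nonzeroModMaximal_smul_mem (M := M) Q c
  obtain ⟨n₂, h₂⟩ := PolynomialModule.exists_forall_mem_pow_succ_smul (M := M) hc
  have hcQ : c ∈ Q.map C := Ideal.mem_map_C_iff.2 fun i => by
    rw [hc]; exact Ideal.subset_span ⟨i, rfl⟩
  obtain ⟨f', hf'm, hf'i, hf'c⟩ := Polynomial.exists_monic_irreducible_isCoprime
    (mem_nonzeroModMaximal.1 hf₀)
  obtain ⟨f, hff', -, hf⟩ := Polynomial.lifts_and_natDegree_eq_and_monic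
    ((Polynomial.lifts_iff_coeff_lifts _).2 fun n => residue_surjective _) hf'm
  refine ⟨f, hf, hff' ▸ hf'i, max n₁ n₂, fun n hn g hg b hb => ?_⟩
  obtain ⟨u', v', huv'⟩ := hf'c
  obtain ⟨u, rfl⟩ := Polynomial.map_surjective _ (residue_surjective (R := R)) u'
  obtain ⟨v, rfl⟩ := Polynomial.map_surjective _ (residue_surjective (R := R)) v'
  obtain ⟨w, hw⟩ : ∃ w, w = 1 - (u * f + v * f₀) := ⟨_, rfl⟩
  have hwm : w ∈ (maximalIdeal R).map C := by
    rw [← ker_residue, ← Polynomial.ker_mapRingHom, RingHom.mem_ker, coe_mapRingHom, hw,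
      Polynomial.map_sub, Polynomial.map_add, Polynomial.map_mul, Polynomial.map_mul, hff', huv',
      Polynomial.map_one, sub_self]
  have hfb : f • b ∈ ((Q ^ (n + 1)).map C • ⊤ : Submodule R[X] (PolynomialModule R M)) := by
    have := Submodule.sub_mem _ (smul_mem_map_C_pow_succ hcQ hg)
      (map_C_pow_smul_mono (n.succ.le_succ) hb)
    simpa using this
  have hb1 := PolynomialModule.mem_of_monic_smul_mem hf hfb
  have hfE : f • b ∈ superficialImage M Q c n := by
    refine mem_superficialImage.2 ⟨g, hg, ?_⟩
    rw [← neg_sub]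
    exact Submodule.neg_mem _ hb
  have hf₀E := h₁ n (by omega) b hb1 ⟨f, mem_nonzeroModMaximal.2
    (by rw [hff']; exact hf'm.ne_zero), hfE⟩
  have hwb : (1 - w) • b ∈ superficialImage M Q c n := by
    have : (1 - w) • b = u • f • b + v • f₀ • b := by
      rw [← mul_smul, ← mul_smul, ← add_smul]; congr 1; rw [hw]; ring
    rw [this]
    exact Submodule.add_mem _ (Submodule.smul_mem _ _ hfE) (Submodule.smul_mem _ _ hf₀E)
  obtain ⟨a, ha⟩ := hd
  have hwab : w ^ a • b ∈ ((Q ^ (n + 2)).map C • ⊤ : Submodule R[X] (PolynomialModule R M)) := by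
    have hwa : w ^ a ∈ (maximalIdeal R ^ a).map C := by
      rw [Ideal.map_pow]; exact Ideal.pow_mem_pow hwm a
    rw [PolynomialModule.mem_map_C_smul_top_iff] at hb1 ⊢
    intro j
    rw [PolynomialModule.smul_apply]
    exact Submodule.sum_mem _ fun x _ => smul_mem_pow_succ_smul_of_mem_sup_annihilator
      (ha (Ideal.mem_map_C_iff.1 hwa _)) (hb1 _)
  have hbE : b ∈ superficialImage M Q c n := by
    have h3 : b = (∑ i ∈ range a, w ^ i) • (1 - w) • b + w ^ a • b := by
      rw [← mul_smul, ← add_smul, geom_sum_mul_neg, sub_add_cancel, one_smul]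
    rw [h3]
    exact Submodule.add_mem _ (Submodule.smul_mem _ _ hwb) (Submodule.mem_sup_right hwab)
  obtain ⟨g', hg', hbg⟩ := mem_superficialImage.1 hbE
  refine ⟨g', h₂ n (by omega) _ (Submodule.sub_mem _ hg (Submodule.smul_mem _ _ hg')) ?_⟩
  have : c • (g - f • g') = (c • g - f • b) + f • (b - c • g') := by
    rw [smul_sub, smul_sub, smul_comm c f]; abel
  rw [this]
  exact Submodule.add_mem _ hb (Submodule.smul_mem _ _ hbg)

end PolynomialExtension

section ResidueFieldExtension

open Polynomial TensorProduct

theorem isLocalRing_of_map_isMaximal {R S : Type*} [CommRing R] [IsLocalRing R] [CommRing S]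
    [Algebra R S] [Algebra.IsIntegral R S]
    (h : ((maximalIdeal R).map (algebraMap R S)).IsMaximal) : IsLocalRing S := by
  refine IsLocalRing.of_unique_max_ideal ⟨_, h, fun J hJ => ?_⟩
  haveI : J.IsMaximal := hJ
  have h1 := IsLocalRing.eq_maximalIdeal (Ideal.isMaximal_comap_of_isIntegral_of_isMaximal (R := R) J)
  exact (h.eq_of_le hJ.ne_top (Ideal.map_le_iff_le_comap.2 h1.ge)).symm

theorem AdjoinRoot.isMaximal_map_maximalIdeal {R : Type*} [CommRing R] [IsLocalRing R] {f : R[X]}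
    (hf : Irreducible (f.map (residue R))) :
    ((maximalIdeal R).map (algebraMap R (AdjoinRoot f))).IsMaximal := by
  rw [AdjoinRoot.algebraMap_eq]
  haveI : (Ideal.span {f.map (residue R)}).IsMaximal :=
    PrincipalIdealRing.isMaximal_of_irreducible hf
  refine Ideal.Quotient.maximal_of_isField _ (MulEquiv.isField
    ((Ideal.Quotient.maximal_ideal_iff_isField_quotient (Ideal.span {f.map (residue R)})).1 this)
    (AdjoinRoot.quotAdjoinRootEquivQuotPolynomialQuot (maximalIdeal R) f).toMulEquiv)

theorem mem_map_smul_top_iff_of_semilinear {A B N N' : Type*} [CommRing A] [CommRing B]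
    [AddCommGroup N] [Module A N] [AddCommGroup N'] [Module B N'] {φ : A →+* B}
    (hφ : Function.Surjective φ) {π : N →+ N'} (hπ : Function.Surjective π)
    (h : ∀ a z, π (a • z) = φ a • π z) (I : Ideal A) (u : N') :
    u ∈ (I.map φ • ⊤ : Submodule B N') ↔ ∃ g ∈ (I • ⊤ : Submodule A N), π g = u := by
  constructor
  · intro hu
    induction hu using Submodule.smul_induction_on' with
    | smul r hr m _ =>
      obtain ⟨a, ha, rfl⟩ := (Ideal.mem_map_iff_of_surjective φ hφ).1 hr
      obtain ⟨z, rfl⟩ := hπ m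
      exact ⟨a • z, Submodule.smul_mem_smul ha trivial, h a z⟩
    | add x _ y _ hx hy =>
      obtain ⟨a, ha, rfl⟩ := hx
      obtain ⟨b, hb, rfl⟩ := hy
      exact ⟨a + b, Submodule.add_mem _ ha hb, map_add _ _ _⟩
  · rintro ⟨g, hg, rfl⟩
    induction hg using Submodule.smul_induction_on' with
    | smul r hr m _ =>
      rw [h]
      exact Submodule.smul_mem_smul (Ideal.mem_map_of_mem _ hr) trivial
    | add x _ y _ hx hy => rw [map_add]; exact Submodule.add_mem _ hx hy

theorem AdjoinRoot.exists_polynomialModule_map {R : Type*} [CommRing R] (M : Type*)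
    [AddCommGroup M] [Module R M] (f : R[X]) :
    ∃ π : PolynomialModule R M →+ AdjoinRoot f ⊗[R] M, Function.Surjective π ∧
      (∀ p z, π (p • z) = AdjoinRoot.mk f p • π z) ∧ ∀ z, π z = 0 → ∃ b, z = f • b := by
  let e := PolynomialModule.polynomialTensorProductLEquivPolynomialModule R M
  let ρ : R[X] ⊗[R] M →ₗ[R] AdjoinRoot f ⊗[R] M :=
    LinearMap.rTensor M (AdjoinRoot.mkₐ f).toLinearMap
  have hρs : Function.Surjective ρ := LinearMap.rTensor_surjective M AdjoinRoot.mk_surjective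
  have hρ : ∀ (p : R[X]) w, ρ (p • w) = AdjoinRoot.mk f p • ρ w := by
    intro p w
    induction w using TensorProduct.induction_on with
    | zero => simp
    | add x y hx hy => rw [smul_add, map_add, hx, hy, map_add, smul_add]
    | tmul q m =>
      rw [TensorProduct.smul_tmul']
      change AdjoinRoot.mk f (p * q) ⊗ₜ[R] m = AdjoinRoot.mk f p • (AdjoinRoot.mk f q ⊗ₜ[R] m)
      rw [TensorProduct.smul_tmul', smul_eq_mul, map_mul]
  have hex : Function.Exact (LinearMap.mulLeft R f) (AdjoinRoot.mkₐ f).toLinearMap := by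
    intro p
    change AdjoinRoot.mk f p = 0 ↔ _
    rw [AdjoinRoot.mk_eq_zero]
    constructor
    · rintro ⟨q, rfl⟩; exact ⟨q, rfl⟩
    · rintro ⟨q, rfl⟩; exact ⟨q, rfl⟩
  have hker := rTensor_exact M hex AdjoinRoot.mk_surjective
  have hmul : ∀ w, LinearMap.rTensor M (LinearMap.mulLeft R f) w = f • w := by
    intro w
    induction w using TensorProduct.induction_on with
    | zero => simp
    | add x y hx hy => rw [map_add, hx, hy, smul_add]
    | tmul q m => rfl
  refine ⟨ρ.toAddMonoidHom.comp e.symm.toLinearMap.toAddMonoidHom, hρs.comp e.symm.surjective,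
    fun p z => ?_, fun z hz => ?_⟩
  · change ρ (e.symm (p • z)) = AdjoinRoot.mk f p • ρ (e.symm z)
    rw [map_smul, hρ]
  · obtain ⟨w, hw⟩ := (hker (e.symm z)).1 hz
    refine ⟨e w, ?_⟩
    rw [← map_smul, ← hmul, hw, LinearEquiv.apply_symm_apply]

/-- After a finite free extension, a parameter system of a module can be changed so that its
first member is superficial. -/
theorem exists_superficial_extension.{u, v} {R : Type u} [CommRing R] [IsLocalRing R]
    [IsNoetherianRing R] {M : Type v} [AddCommGroup M] [Module R M] [Module.Finite R M] {Q : Ideal R}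
    {s : ℕ} {x : Fin (s + 1) → R} (hx : ∀ i, x i ∈ maximalIdeal R)
    (hQ : Q = Ideal.span (Set.range x)) (hd : IsIdealOfDefinition Q M)
    (hM : IsTorsionFreeFor Q M) :
    ∃ (S : Type u) (_ : CommRing S) (_ : IsLocalRing S) (_ : IsNoetherianRing S) (_ : Algebra R S)
      (_ : Module.Free R S) (_ : Module.Finite R S) (_ : IsLocalHom (algebraMap R S)),
      (maximalIdeal R).map (algebraMap R S) = maximalIdeal S ∧
      ∃ (c : S) (y : Fin s → S), c ∈ maximalIdeal S ∧ (∀ i, y i ∈ maximalIdeal S) ∧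
        Q.map (algebraMap R S) = Ideal.span {c} ⊔ Ideal.span (Set.range y) ∧
        IsSMulRegular (S ⊗[R] M) c ∧ ∃ N, ∀ n ≥ N,
          hilbertSamuel (Q.map (algebraMap R S)) (S ⊗[R] M) (n + 1) =
            hilbertSamuel (Q.map (algebraMap R S)) (QuotSMulTop c (S ⊗[R] M)) (n + 1) +
              hilbertSamuel (Q.map (algebraMap R S)) (S ⊗[R] M) n := by
  have hQm : Q ≤ maximalIdeal R := by
    rw [hQ, Ideal.span_le]
    rintro _ ⟨i, rfl⟩
    exact hx i
  have hcoeff : ∀ i : Fin (s + 1), (∑ j : Fin (s + 1), monomial (j : ℕ) (x j)).coeff i = x i := by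
    intro i
    rw [finsetSum_coeff, Finset.sum_eq_single i]
    · rw [coeff_monomial_same]
    · intro j _ hj
      rw [coeff_monomial_of_ne]
      exact fun h => hj (Fin.ext h.symm)
    · simp
  obtain ⟨C₀, hC₀⟩ : ∃ C₀ : R[X], C₀ = ∑ j : Fin (s + 1), monomial (j : ℕ) (x j) := ⟨_, rfl⟩
  rw [← hC₀] at hcoeff
  have hC₀Q : Q = Ideal.span (Set.range C₀.coeff) := by
    apply le_antisymm
    · rw [hQ, Ideal.span_le]
      rintro _ ⟨i, rfl⟩
      exact Ideal.subset_span ⟨i, hcoeff i⟩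
    · rw [Ideal.span_le]
      rintro _ ⟨i, rfl⟩
      rw [hC₀, finsetSum_coeff]
      refine Ideal.sum_mem _ fun j _ => ?_
      rw [coeff_monomial]
      split_ifs
      · rw [hQ]; exact Ideal.subset_span ⟨j, rfl⟩
      · exact Ideal.zero_mem _
  obtain ⟨f, hf, hfi, n₁, hn₁⟩ := exists_monic_superficial hd hC₀Q
  haveI : Module.Free R (AdjoinRoot f) := hf.free_adjoinRoot
  haveI : Module.Finite R (AdjoinRoot f) := hf.finite_adjoinRoot
  have hmax := AdjoinRoot.isMaximal_map_maximalIdeal hfi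
  haveI : IsLocalRing (AdjoinRoot f) := isLocalRing_of_map_isMaximal hmax
  haveI : IsNoetherianRing (AdjoinRoot f) := IsNoetherianRing.of_finite R _
  have hm := IsLocalRing.eq_maximalIdeal hmax
  haveI : IsLocalHom (algebraMap R (AdjoinRoot f)) :=
    ((IsLocalRing.local_hom_TFAE (algebraMap R (AdjoinRoot f))).out 0 2).2 hm.le
  obtain ⟨π, hπs, hπ, hπk⟩ := AdjoinRoot.exists_polynomialModule_map M f
  have hym : ∀ i, algebraMap R (AdjoinRoot f) (x i) ∈ maximalIdeal (AdjoinRoot f) := fun i => by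
    rw [← hm]; exact Ideal.mem_map_of_mem _ (hx i)
  have hmapC : ∀ I : Ideal R, (I.map C).map (AdjoinRoot.mk f) =
      I.map (algebraMap R (AdjoinRoot f)) := fun I => by
    rw [Ideal.map_map]; rfl
  have hcQ : AdjoinRoot.mk f C₀ ∈ Q.map (algebraMap R (AdjoinRoot f)) := by
    rw [← hmapC]
    refine Ideal.mem_map_of_mem _ (Ideal.mem_map_C_iff.2 fun i => ?_)
    rw [hC₀Q]; exact Ideal.subset_span ⟨i, rfl⟩
  have hQm' : Q.map (algebraMap R (AdjoinRoot f)) ≤ maximalIdeal (AdjoinRoot f) := by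
    rw [← hm]; exact Ideal.map_mono hQm
  have htf : IsTorsionFreeFor (Q.map (algebraMap R (AdjoinRoot f))) (AdjoinRoot f ⊗[R] M) := by
    refine fun k u hu => eq_zero_of_forall_repr u fun φ => hM k _ fun q hq => ?_
    rw [← map_smul, ← algebraMap_smul (AdjoinRoot f) q u,
      hu _ (by rw [← Ideal.map_pow]; exact Ideal.mem_map_of_mem _ hq), map_zero]
  have hpow : ∀ n u, u ∈ ((Q.map (algebraMap R (AdjoinRoot f))) ^ n • ⊤ :
      Submodule (AdjoinRoot f) (AdjoinRoot f ⊗[R] M)) ↔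
      ∃ g ∈ ((Q ^ n).map C • ⊤ : Submodule R[X] (PolynomialModule R M)), π g = u := fun n u => by
    rw [← Ideal.map_pow, ← hmapC]
    exact mem_map_smul_top_iff_of_semilinear AdjoinRoot.mk_surjective hπs hπ _ u
  have hsup := hilbertSamuel_quotSMulTop_of_superficial hQm' (hd.baseChange hm) htf hcQ (n₁ := n₁)
    fun n hn u hu hcu => by
      obtain ⟨g, hg, rfl⟩ := (hpow _ _).1 hu
      obtain ⟨q, hq, hqg⟩ := (hpow _ _).1 hcu
      obtain ⟨b, hb⟩ := hπk (C₀ • g - q) (by rw [map_sub, hπ, hqg, sub_self])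
      obtain ⟨g', hg'⟩ := hn₁ n hn g hg b (by rw [← hb]; simpa using hq)
      refine (hpow _ _).2 ⟨_, hg', ?_⟩
      rw [map_sub, hπ, AdjoinRoot.mk_self, zero_smul, sub_zero]
  refine ⟨AdjoinRoot f, inferInstance, inferInstance, inferInstance, inferInstance, inferInstance,
    inferInstance, inferInstance, hm, AdjoinRoot.mk f C₀, fun i => algebraMap R _ (x i.succ),
    hQm' hcQ, fun i => hym _, ?_, hsup⟩
  apply le_antisymm
  · rw [Ideal.map_le_iff_le_comap, hQ, Ideal.span_le]
    have hsucc : ∀ i : Fin s, algebraMap R (AdjoinRoot f) (x i.succ) ∈ Ideal.span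
        {AdjoinRoot.mk f C₀} ⊔ Ideal.span (Set.range fun i : Fin s => algebraMap R _ (x i.succ)) :=
      fun i => Ideal.mem_sup_right (Ideal.subset_span ⟨i, rfl⟩)
    rintro _ ⟨i, rfl⟩
    refine Fin.cases ?_ (fun i => hsucc i) i
    have h0 : AdjoinRoot.mk f C₀ = algebraMap R (AdjoinRoot f) (x 0) +
        ∑ i : Fin s, AdjoinRoot.mk f X ^ ((i : ℕ) + 1) * algebraMap R _ (x i.succ) := by
      rw [hC₀, Fin.sum_univ_succ, map_add, map_sum]
      congr 1
      refine Finset.sum_congr rfl fun i _ => ?_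
      rw [← C_mul_X_pow_eq_monomial, map_mul, map_pow, mul_comm]
      rfl
    have h1 : algebraMap R (AdjoinRoot f) (x 0) = AdjoinRoot.mk f C₀ -
        ∑ i : Fin s, AdjoinRoot.mk f X ^ ((i : ℕ) + 1) * algebraMap R _ (x i.succ) := by
      rw [h0, add_sub_cancel_right]
    rw [SetLike.mem_coe, Ideal.mem_comap]
    rw [h1]
    exact Ideal.sub_mem _ (Ideal.mem_sup_left (Ideal.mem_span_singleton_self _))
      (Ideal.sum_mem _ fun i _ => Ideal.mul_mem_left _ _ (hsucc i))
  · refine sup_le ((Ideal.span_singleton_le_iff_mem _).2 hcQ) (Ideal.span_le.2 ?_)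
    rintro _ ⟨i, rfl⟩
    refine Ideal.mem_map_of_mem _ ?_
    rw [hQ]; exact Ideal.subset_span ⟨_, rfl⟩

end ResidueFieldExtension

section Connectedness

open scoped Pointwise

variable {R : Type*} [CommRing R] [IsLocalRing R] [IsNoetherianRing R]
  {M N L : Type*} [AddCommGroup M] [Module R M] [AddCommGroup N] [Module R N]
  [AddCommGroup L] [Module R L] {Q : Ideal R} {r : ℕ}

theorem DimLT.of_ker_le [Module.Finite R M] [Module.Finite R N] (hd : IsIdealOfDefinition Q M)
    (hM : DimLT Q r M) (g : N →ₗ[R] M) (q : N →ₗ[R] L) (hq : Function.Surjective q)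
    (h : LinearMap.ker g ≤ LinearMap.ker q) : DimLT Q r L := by
  have hinj : Function.Injective ((LinearMap.ker g).liftQ g le_rfl) := by
    rw [← LinearMap.ker_eq_bot]; exact Submodule.ker_liftQ_eq_bot _ _ _ le_rfl
  refine DimLT.of_surjective (hd.of_injective _ hinj) ((LinearMap.ker g).liftQ q h) ?_
    (hM.of_injective hd _ hinj)
  intro l
  obtain ⟨n, rfl⟩ := hq l
  exact ⟨Submodule.Quotient.mk n, rfl⟩

theorem DimLT.quotient_ker_toSpanSingleton [Module.Finite R M] (hd : IsIdealOfDefinition Q M)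
    {P : Submodule R M} (hP : DimLT Q r P) {b : M} (hb : b ∈ P) :
    IsIdealOfDefinition Q (R ⧸ LinearMap.ker (LinearMap.toSpanSingleton R M b)) ∧
      DimLT Q r (R ⧸ LinearMap.ker (LinearMap.toSpanSingleton R M b)) := by
  constructor
  · refine hd.of_injective ((LinearMap.ker _).liftQ (LinearMap.toSpanSingleton R M b) le_rfl) ?_
    rw [← LinearMap.ker_eq_bot]; exact Submodule.ker_liftQ_eq_bot _ _ _ le_rfl
  · refine DimLT.of_ker_le (hd.submodule P) hP (LinearMap.toSpanSingleton R P ⟨b, hb⟩)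
      (Submodule.mkQ _) (Submodule.mkQ_surjective _) ?_
    rw [Submodule.ker_mkQ]
    intro c hc
    exact congrArg Subtype.val (LinearMap.mem_ker.1 hc)

theorem NoSmallSubmodule.eq_zero_of_forall_smul_eq_zero (hM : NoSmallSubmodule Q r M) {I : Ideal R}
    (hdI : IsIdealOfDefinition Q (R ⧸ I)) (hI : DimLT Q r (R ⧸ I)) {b : M}
    (hb : ∀ c ∈ I, c • b = 0) : b = 0 := by
  let g : (R ⧸ I) →ₗ[R] M := I.liftQ (LinearMap.toSpanSingleton R M b) hb
  have h1 : DimLT Q r (LinearMap.range g) := hI.of_surjective hdI g.rangeRestrict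
    g.surjective_rangeRestrict
  have h2 := hM _ h1
  rw [LinearMap.range_eq_bot] at h2
  have h3 := LinearMap.congr_fun h2 (Submodule.Quotient.mk 1)
  have h4 : g (Submodule.Quotient.mk 1) = (1 : R) • b := rfl
  rw [h4, one_smul] at h3
  exact h3

variable [Module.Finite R M] {x : R}

theorem IsSMulRegular.exists_linearMap_of_smul_mem (hx : IsSMulRegular M x) (k : ℕ) {I : Ideal R}
    {u : M} (hu : ∀ c ∈ I, c • u ∈ (x ^ k • ⊤ : Submodule R M)) :
    ∃ φ : I →ₗ[R] M, ∀ c : I, (c : R) • u = x ^ k • φ c := by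
  have hxk : IsSMulRegular M (x ^ k) := hx.pow k
  choose φ hφ using fun c : I => mem_smul_top_iff.1 (hu c c.2)
  exact ⟨{ toFun := φ
           map_add' := fun a b => hxk (by
            change x ^ k • φ (a + b) = x ^ k • (φ a + φ b)
            rw [smul_add, hφ, hφ, hφ, ← add_smul]; rfl)
           map_smul' := fun a b => hxk (by
            change x ^ k • φ (a • b) = x ^ k • (a • φ b)
            rw [smul_comm, hφ, hφ, ← mul_smul]; rfl) }, fun c => (hφ c).symm⟩

/-- A form of the vanishing of a finite local cohomology module. -/
theorem eq_bot_of_hasDepthGE_quotient.{v} {R : Type*} [CommRing R] [IsLocalRing R]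
    [IsNoetherianRing R] {M : Type v} [AddCommGroup M] [Module R M] [Module.Finite R M] {Q : Ideal R}
    {x : R} {t : ℕ} (hR : IsChevalley.{v} R)
    (hQ : Q ≤ maximalIdeal R) (hd : IsIdealOfDefinition Q M) (hM : NoSmallSubmodule Q (t + 2) M)
    (hxQ : x ∈ Q) (hx : IsSMulRegular M x) {P : Submodule R (QuotSMulTop x M)}
    (hP : DimLT Q (t + 1) P) (hdepth : HasDepthGE R (t + 2) (QuotSMulTop x M ⧸ P)) : P = ⊥ := by
  choose P' hP' hmax hsmall using fun k : ℕ =>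
    exists_smallPart (hd.quotient (x ^ k • ⊤ : Submodule R M)) (t + 1)
  obtain ⟨V, hV⟩ : ∃ V : ℕ → Submodule R M,
      ∀ k, V k = (P' k).comap (Submodule.mkQ (x ^ k • ⊤ : Submodule R M)) := ⟨_, fun _ => rfl⟩
  have hVmem : ∀ k u, u ∈ V k ↔ Submodule.mkQ (x ^ k • ⊤ : Submodule R M) u ∈ P' k := by
    intro k u; rw [hV, Submodule.mem_comap]
  have hle : ∀ k, (x ^ (k + 1) • ⊤ : Submodule R M) ≤ x ^ k • ⊤ := by
    intro k m hm
    obtain ⟨w, rfl⟩ := mem_smul_top_iff.1 hm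
    exact mem_smul_top_iff.2 ⟨x • w, by rw [← mul_smul, ← pow_succ]⟩
  have hanti : Antitone V := by
    refine antitone_nat_of_succ_le fun k u hu => ?_
    let g : (M ⧸ (x ^ (k + 1) • ⊤ : Submodule R M)) →ₗ[R] M ⧸ (x ^ k • ⊤ : Submodule R M) :=
      Submodule.mapQ _ _ LinearMap.id (hle k)
    have h1 : DimLT Q (t + 1) ((P' (k + 1)).map g) :=
      (hP' (k + 1)).of_surjective ((hd.quotient _).submodule _) (g.submoduleMap _)
        (g.submoduleMap_surjective _)
    exact (hVmem _ _).2 (hmax k _ h1 ⟨_, (hVmem _ _).1 hu, rfl⟩)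
  have hshift : ∀ k (m : M), Submodule.mkQ (x • ⊤ : Submodule R M) m ∈ P → x ^ k • m ∈ V (k + 1) := by
    intro k m hm
    let g : QuotSMulTop x M →ₗ[R] M ⧸ (x ^ (k + 1) • ⊤ : Submodule R M) :=
      Submodule.mapQ _ _ (LinearMap.lsmul R M (x ^ k)) (by
        intro m hm
        obtain ⟨w, rfl⟩ := mem_smul_top_iff.1 hm
        exact mem_smul_top_iff.2 ⟨w, by rw [LinearMap.lsmul_apply, ← mul_smul, ← pow_succ]⟩)
    have h1 : DimLT Q (t + 1) (P.map g) :=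
      hP.of_surjective ((hd.quotient _).submodule _) (g.submoduleMap _) (g.submoduleMap_surjective _)
    exact (hVmem _ _).2 (hmax _ _ h1 ⟨_, hm, rfl⟩)
  have hstep : ∀ k, ∀ u ∈ V k, ∃ w : M, u - x ^ k • w ∈ V (k + 1) := by
    intro k u hu
    obtain ⟨hdI, hI⟩ := DimLT.quotient_ker_toSpanSingleton (hd.quotient _) (hP' k) ((hVmem k u).1 hu)
    set I : Ideal R := LinearMap.ker (LinearMap.toSpanSingleton R (M ⧸ (x ^ k • ⊤ : Submodule R M))
      (Submodule.mkQ (x ^ k • ⊤ : Submodule R M) u)) with hIdef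
    obtain ⟨φ, hφ⟩ := hx.exists_linearMap_of_smul_mem k (I := I) (u := u) fun c hc =>
      (Submodule.Quotient.mk_eq_zero _).1 hc
    obtain ⟨w', hw'⟩ := exists_forall_apply_eq_smul hQ ((hd.quotient _).quotient P) hdepth I hdI hI
      (P.mkQ ∘ₗ Submodule.mkQ (x • ⊤ : Submodule R M) ∘ₗ φ)
    obtain ⟨w'', rfl⟩ := Submodule.mkQ_surjective _ w'
    obtain ⟨w, rfl⟩ := Submodule.mkQ_surjective _ w''
    refine ⟨w, (hVmem _ _).2 ?_⟩
    rw [← Submodule.Quotient.mk_eq_zero (P' (k + 1))]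
    refine (hsmall (k + 1)).eq_zero_of_forall_smul_eq_zero hdI hI fun c hc => ?_
    have h1 : Submodule.mkQ (x • ⊤ : Submodule R M) (φ ⟨c, hc⟩ - c • w) ∈ P := by
      rw [← Submodule.Quotient.mk_eq_zero P, ← Submodule.mkQ_apply, map_sub, map_sub, map_smul,
        map_smul, sub_eq_zero]
      exact hw' ⟨c, hc⟩
    have h2 := (hVmem _ _).1 (hshift k _ h1)
    rw [smul_sub, ← hφ ⟨c, hc⟩, smul_comm, ← smul_sub, map_smul] at h2
    exact (Submodule.Quotient.mk_eq_zero _).2 h2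
  have hJ : ⨅ k, V k = ⊥ := by
    set J := ⨅ k, V k with hJdef
    obtain ⟨k, hk⟩ := exists_forall_inf_le (Ideal.span {x}) J
    refine hM J (dimLT_succ_of_quotSMulTop (hd.submodule J) hxQ ?_)
    have hJV : ∀ u ∈ J, Submodule.mkQ (x ^ (1 + k) • ⊤ : Submodule R M) u ∈ P' (1 + k) := fun u hu =>
      (hVmem _ _).1 ((iInf_le V (1 + k)) hu)
    refine DimLT.of_ker_le ((hd.quotient _).submodule (P' (1 + k))) (hP' (1 + k))
      ((Submodule.mkQ (x ^ (1 + k) • ⊤ : Submodule R M)).restrict hJV)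
      (Submodule.mkQ (x • ⊤ : Submodule R J)) (Submodule.mkQ_surjective _) ?_
    rw [Submodule.ker_mkQ]
    rintro ⟨u, hu⟩ h
    have h1 : u ∈ (x ^ (1 + k) • ⊤ : Submodule R M) :=
      (Submodule.Quotient.mk_eq_zero _).1 (congrArg Subtype.val (LinearMap.mem_ker.1 h))
    have h2 := hk 1 (Submodule.mem_inf.2 ⟨by
      rwa [Ideal.span_singleton_pow, Submodule.ideal_span_singleton_smul], hu⟩)
    rw [pow_one, Submodule.ideal_span_singleton_smul] at h2
    obtain ⟨v, hv, hvu⟩ := h2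
    exact mem_smul_top_iff.2 ⟨⟨v, hv⟩, Subtype.ext hvu⟩
  have hsplit : ∀ k, ∀ u : M, Submodule.mkQ (x • ⊤ : Submodule R M) u ∈ P →
      ∃ w : M, u - x • w ∈ V (k + 1) := by
    intro k u hu
    induction k with
    | zero => exact ⟨0, by simpa using hshift 0 u hu⟩
    | succ k ih =>
      obtain ⟨w, hw⟩ := ih
      obtain ⟨w', hw'⟩ := hstep _ _ hw
      refine ⟨w + x ^ k • w', ?_⟩
      rwa [smul_add, ← mul_smul, ← pow_succ', ← sub_sub]
  rw [eq_bot_iff]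
  intro a ha
  obtain ⟨u, rfl⟩ := Submodule.mkQ_surjective _ a
  have h1 : Submodule.mkQ (x • ⊤ : Submodule R M) u ∈
      ⨅ n : ℕ, (maximalIdeal R ^ n • ⊤ : Submodule R (QuotSMulTop x M)) := by
    rw [Submodule.mem_iInf]
    intro n
    obtain ⟨k, hk⟩ := hR M V hanti hJ n
    obtain ⟨w, hw⟩ := hsplit k u ha
    have h2 := pow_smul_top_le_comap (maximalIdeal R) (Submodule.mkQ (x • ⊤ : Submodule R M)) n
      (hk (hanti (Nat.le_succ k) hw))
    rw [Submodule.mem_comap, map_sub] at h2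
    have h3 : Submodule.mkQ (x • ⊤ : Submodule R M) (x • w) = 0 :=
      (Submodule.Quotient.mk_eq_zero _).2 (mem_smul_top_iff.2 ⟨w, rfl⟩)
    rwa [h3, sub_zero] at h2
  rwa [Ideal.iInf_pow_smul_eq_bot_of_isLocalRing _ (maximalIdeal.isMaximal R).ne_top] at h1

end Connectedness

section Coefficients

open scoped Pointwise TensorProduct

theorem HasCoeffs.add_const {f : ℕ → ℤ} {s : ℕ} {e : ℕ → ℤ} (hf : HasCoeffs f s e) (K : ℤ) :
    HasCoeffs (fun n => f n + K) s (fun i => e i + if i = s then (-1) ^ s * K else 0) := by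
  obtain ⟨N, h⟩ := hf
  refine ⟨N, fun n hn => ?_⟩
  change f (n + 1) + K = _
  rw [h n hn]
  have h1 : ∀ i ∈ range (s + 1), (-1 : ℤ) ^ i * (e i + if i = s then (-1) ^ s * K else 0) *
      ((n + s - i).choose (s - i)) = (-1) ^ i * e i * ((n + s - i).choose (s - i)) +
      if i = s then K else 0 := by
    intro i _
    split_ifs with hi
    · subst hi
      have : ((-1 : ℤ) ^ i) * (-1) ^ i = 1 := by rw [← mul_pow]; simp
      rw [Nat.sub_self, Nat.choose_zero_right, Nat.cast_one]
      linear_combination K * this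
    · ring
  rw [Finset.sum_congr rfl h1, Finset.sum_add_distrib, Finset.sum_ite_eq' (range (s + 1)) s]
  simp

variable {R : Type*} [CommRing R] [IsLocalRing R] [IsNoetherianRing R]
  {M N : Type*} [AddCommGroup M] [Module R M] [AddCommGroup N] [Module R N] {Q : Ideal R}

section Annihilated

variable {c : R} {J : Ideal R}

theorem sup_span_pow_smul_top (h : ∀ u : M, c • u = 0) (n : ℕ) :
    ((Ideal.span {c} ⊔ J) ^ n • ⊤ : Submodule R M) = J ^ n • ⊤ := by
  induction n with
  | zero => rw [pow_zero, pow_zero]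
  | succ n ih =>
    rw [pow_succ', pow_succ', Submodule.mul_smul, ih, Submodule.sup_smul, Submodule.mul_smul]
    refine sup_eq_right.2 (le_trans (le_of_eq ?_) bot_le)
    rw [eq_bot_iff, Submodule.smul_le]
    intro r hr u _
    obtain ⟨a, rfl⟩ := Ideal.mem_span_singleton'.1 hr
    rw [mul_smul, h, smul_zero]
    exact Submodule.zero_mem _

theorem hilbertSamuel_sup_span (h : ∀ u : M, c • u = 0) :
    hilbertSamuel (Ideal.span {c} ⊔ J) M = hilbertSamuel J M := by
  funext n
  unfold hilbertSamuel
  rw [sup_span_pow_smul_top h]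

theorem IsIdealOfDefinition.of_sup_span (h : ∀ u : M, c • u = 0)
    (hd : IsIdealOfDefinition (Ideal.span {c} ⊔ J) M) : IsIdealOfDefinition J M := by
  obtain ⟨a, ha⟩ := hd
  refine ⟨a, ha.trans (sup_le (sup_le ?_ le_sup_left) le_sup_right)⟩
  rw [Ideal.span_singleton_le_iff_mem]
  exact Ideal.mem_sup_right (Module.mem_annihilator.2 h)

theorem QuotSMulTop.smul_eq_zero (u : QuotSMulTop c M) : c • u = 0 := by
  obtain ⟨m, rfl⟩ := Submodule.mkQ_surjective _ u
  exact (Submodule.Quotient.mk_eq_zero _).2 (mem_smul_top_iff.2 ⟨m, rfl⟩)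

end Annihilated

theorem NoSmallSubmodule.isTorsionFreeFor [Module.Finite R M] {s : ℕ} (hs : 1 ≤ s)
    (h : NoSmallSubmodule Q s M) : IsTorsionFreeFor Q M := by
  intro k u hu
  suffices hK : DimLT Q 1 (Submodule.span R {u}) by
    have := h _ (hK.mono hs)
    exact (Submodule.mem_bot R).1 (this ▸ Submodule.mem_span_singleton_self u)
  have hbot : (Q ^ k • ⊤ : Submodule R (Submodule.span R {u})) = ⊥ := by
    rw [eq_bot_iff, Submodule.smul_le]
    rintro q hq ⟨v, hv⟩ _
    obtain ⟨a, rfl⟩ := Submodule.mem_span_singleton.1 hv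
    refine (Submodule.mem_bot R).2 (Subtype.ext ?_)
    change q • a • u = 0
    rw [smul_comm, hu q hq, smul_zero]
  refine GrowthLE.of_eventually (C := hilbertSamuel Q (Submodule.span R {u}) k) (N := k)
    fun n hn => ?_
  have h1 : hilbertSamuel Q (Submodule.span R {u}) n = hilbertSamuel Q (Submodule.span R {u}) k := by
    have h2 : (Q ^ n • ⊤ : Submodule R (Submodule.span R {u})) = ⊥ :=
      eq_bot_iff.2 (hbot ▸ Submodule.smul_mono_left (Ideal.pow_le_pow_right hn))
    unfold hilbertSamuel
    rw [h2, hbot]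
  rw [h1, pow_one, abs_of_nonneg (Int.natCast_nonneg _)]

/-- Passing to a quotient by a finite length submodule to get rid of torsion. -/
theorem exists_quotient_isTorsionFreeFor [Module.Finite R M] (hd : IsIdealOfDefinition Q M) :
    ∃ P : Submodule R M, IsTorsionFreeFor Q (M ⧸ P) ∧ ∃ K N : ℕ, ∀ n ≥ N,
      hilbertSamuel Q M n = hilbertSamuel Q (M ⧸ P) n + K := by
  obtain ⟨P, hP, -, hsm⟩ := exists_smallPart hd 1
  refine ⟨P, hsm.isTorsionFreeFor le_rfl, ?_⟩
  have hmono : Monotone (imageLength Q P.subtype) := fun m n hmn =>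
    length_toNat_le_of_surjective ((hd.submodule P).isFiniteLength
      (pow_smul_top_le_comap Q P.subtype n)) (Submodule.mapQ _ _ LinearMap.id
        (Submodule.comap_mono (Submodule.smul_mono_left (Ideal.pow_le_pow_right hmn))))
      fun y => by
        obtain ⟨z, rfl⟩ := Submodule.mkQ_surjective _ y
        exact ⟨Submodule.Quotient.mk z, rfl⟩
  obtain ⟨C, hC⟩ := hP
  have hbd : ∀ n, imageLength Q P.subtype n ≤ C.toNat := fun n => by
    have h1 := hC n
    rw [pow_one, abs_of_nonneg (Int.natCast_nonneg _)] at h1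
    have h2 := le_of_mul_le_mul_right h1 (by positivity)
    have h3 := imageLength_le_hilbertSamuel (hd.submodule P) P.subtype n
    omega
  obtain ⟨N, hN⟩ : ∃ N, ∀ n ≥ N, imageLength Q P.subtype n = imageLength Q P.subtype N := by
    have hfin : (Set.range (imageLength Q P.subtype)).Finite :=
      (Set.finite_Iic C.toNat).subset (by rintro _ ⟨n, rfl⟩; exact hbd n)
    obtain ⟨_, ⟨N, rfl⟩, hN⟩ := Set.exists_max_image _ id hfin ⟨_, 0, rfl⟩
    exact ⟨N, fun n hn => le_antisymm (hN _ ⟨n, rfl⟩) (hmono hn)⟩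
  refine ⟨imageLength Q P.subtype N, N, fun n hn => ?_⟩
  rw [hilbertSamuel_eq_add hd (f := P.subtype) (g := P.mkQ)
    (LinearMap.exact_subtype_mkQ P) (Submodule.mkQ_surjective _), hN n hn]

theorem hilbertSamuel_span_singleton [Module.Finite R M] {x : R} (hx : IsSMulRegular M x)
    (hd : IsIdealOfDefinition (Ideal.span {x}) M) (n : ℕ) :
    hilbertSamuel (Ideal.span {x}) M n =
      n * hilbertSamuel (Ideal.span {x}) (QuotSMulTop x M) 1 := by
  have hpow : ∀ (N : Type _) [AddCommGroup N] [Module R N] (n : ℕ) (m : N),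
      m ∈ (Ideal.span {x} ^ n • ⊤ : Submodule R N) ↔ ∃ w, x ^ n • w = m := by
    intro N _ _ n m
    rw [Ideal.span_singleton_pow, Submodule.ideal_span_singleton_smul, mem_smul_top_iff]
  have hz : ∀ n, hilbertSamuel (Ideal.span {x}) (QuotSMulTop x M) (n + 1) =
      hilbertSamuel (Ideal.span {x}) (QuotSMulTop x M) 1 := by
    intro n
    have h1 : ∀ n, (Ideal.span {x} ^ (n + 1) • ⊤ : Submodule R (QuotSMulTop x M)) = ⊥ := by
      intro n
      rw [eq_bot_iff]
      intro m hm
      obtain ⟨w, rfl⟩ := (hpow _ _ _).1 hm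
      rw [pow_succ, mul_smul, QuotSMulTop.smul_eq_zero, smul_zero]
      exact Submodule.zero_mem _
    have h2 := h1 0
    rw [zero_add] at h2
    unfold hilbertSamuel
    rw [h1, h2]
  induction n with
  | zero => simp [hilbertSamuel, Module.length_eq_zero]
  | succ n ih =>
    rw [hilbertSamuel_eq_add hd (exact_lsmul_mkQ x M) (Submodule.mkQ_surjective _), hz]
    have h1 : (Ideal.span {x} ^ (n + 1) • ⊤ : Submodule R M).comap (LinearMap.lsmul R M x) =
        Ideal.span {x} ^ n • ⊤ := by
      ext m
      rw [Submodule.mem_comap, hpow, hpow, LinearMap.lsmul_apply]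
      constructor
      · rintro ⟨w, hw⟩
        exact ⟨w, hx (by change x • x ^ n • w = x • m; rw [← hw, pow_succ', mul_smul])⟩
      · rintro ⟨w, rfl⟩
        exact ⟨w, by rw [pow_succ', mul_smul]⟩
    have h2 : imageLength (Ideal.span {x}) (LinearMap.lsmul R M x) (n + 1) =
        hilbertSamuel (Ideal.span {x}) M n := by
      unfold imageLength hilbertSamuel
      rw [h1]
    rw [h2, ih]
    ring

theorem hasCoeffs_span_singleton [Module.Finite R M] {x : R} (hx : IsSMulRegular M x)
    (hd : IsIdealOfDefinition (Ideal.span {x}) M) :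
    ∃ e, HasCoeffs (fun n => (hilbertSamuel (Ideal.span {x}) M n : ℤ)) 1 e ∧ e 1 = 0 := by
  refine ⟨fun i => if i = 0 then hilbertSamuel (Ideal.span {x}) (QuotSMulTop x M) 1 else 0,
    ⟨0, fun n _ => ?_⟩, by simp⟩
  change ((hilbertSamuel (Ideal.span {x}) M (n + 1) : ℕ) : ℤ) = _
  rw [hilbertSamuel_span_singleton hx hd]
  simp
  ring

theorem IsTorsionFreeFor.isSMulRegular {x : R} (h : IsTorsionFreeFor (Ideal.span {x}) M) :
    IsSMulRegular M x := by
  refine isSMulRegular_iff_right_eq_zero_of_smul.2 fun u hu => h 1 u fun q hq => ?_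
  rw [pow_one] at hq
  obtain ⟨a, rfl⟩ := Ideal.mem_span_singleton'.1 hq
  rw [mul_smul, hu, smul_zero]

theorem span_range_fin_one (x : Fin (0 + 1) → R) :
    Ideal.span (Set.range x) = Ideal.span {x 0} := by
  congr 1
  ext z
  simp [Fin.exists_fin_one, eq_comm]

/-- Nonpositivity of the first Hilbert coefficient of parameter ideals. -/
theorem exists_hasCoeffs_nonpos.{u, v} (s : ℕ) : ∀ {R : Type u} [CommRing R] [IsLocalRing R]
    [IsNoetherianRing R] {M : Type (max u v)} [AddCommGroup M] [Module R M] [Module.Finite R M]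
    {Q : Ideal R} {x : Fin (s + 1) → R}, (∀ i, x i ∈ maximalIdeal R) →
    Q = Ideal.span (Set.range x) → IsIdealOfDefinition Q M →
    ∃ e, HasCoeffs (fun n => (hilbertSamuel Q M n : ℤ)) (s + 1) e ∧ e 1 ≤ 0 := by
  induction s with
  | zero =>
    intro R _ _ _ M _ _ _ Q x hx hQ hd
    rw [span_range_fin_one] at hQ
    subst hQ
    obtain ⟨P, hP, K, N, hK⟩ := exists_quotient_isTorsionFreeFor hd
    obtain ⟨e, he, he1⟩ := hasCoeffs_span_singleton hP.isSMulRegular (hd.quotient P)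
    refine ⟨_, (he.add_const K).congr (N := N) fun n hn => by rw [hK n hn]; push_cast; rfl, ?_⟩
    simp [he1]
  | succ s ih =>
    intro R _ _ _ M _ _ _ Q x hx hQ hd
    obtain ⟨P, hP, K, N, hK⟩ := exists_quotient_isTorsionFreeFor hd
    obtain ⟨S, _, _, _, _, _, _, _, hm, c, y, hc, hy, hcy, hreg, N', hN'⟩ :=
      exists_superficial_extension hx hQ (hd.quotient P) hP
    have hd' := (hd.quotient P).baseChange (S := S) hm
    have hdS := (hd'.quotient (c • ⊤))
    rw [hcy] at hdS
    obtain ⟨e, he, he1⟩ := ih (M := QuotSMulTop c (S ⊗[R] (M ⧸ P))) hy rfl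
      (hdS.of_sup_span QuotSMulTop.smul_eq_zero)
    rw [← hilbertSamuel_sup_span QuotSMulTop.smul_eq_zero, ← hcy] at he
    obtain ⟨e', he', hee'⟩ := he.sum (f := fun n => (hilbertSamuel Q (M ⧸ P) n : ℤ)) (N := N')
      fun n hn => by
        have := hN' n hn
        rw [hilbertSamuel_baseChange hm, hilbertSamuel_baseChange hm] at this
        rw [this]; push_cast; ring
    refine ⟨_, (he'.add_const K).congr (N := N) fun n hn => by rw [hK n hn]; push_cast; rfl, ?_⟩
    have := hee' 1 (by omega)
    simp only [this]
    rw [if_neg (by omega), add_zero]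
    exact he1

/-- The first Hilbert coefficient of a parameter ideal vanishes in the Cohen–Macaulay case. -/
theorem HasDepthGE.coeff_one_eq_zero.{u, v} (s : ℕ) : ∀ {R : Type u} [CommRing R] [IsLocalRing R]
    [IsNoetherianRing R] {M : Type (max u v)} [AddCommGroup M] [Module R M] [Module.Finite R M]
    {Q : Ideal R} {x : Fin (s + 1) → R} {e : ℕ → ℤ}, (∀ i, x i ∈ maximalIdeal R) →
    Q = Ideal.span (Set.range x) → IsIdealOfDefinition Q M → HasDepthGE R (s + 1) M →
    HasCoeffs (fun n => (hilbertSamuel Q M n : ℤ)) (s + 1) e → e 1 = 0 := by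
  induction s with
  | zero =>
    intro R _ _ _ M _ _ _ Q x e hx hQ hd hdepth he
    rw [span_range_fin_one] at hQ
    subst hQ
    have htf := (hdepth.noSmallSubmodule ((Ideal.span_singleton_le_iff_mem _).2 (hx 0))
      hd).isTorsionFreeFor le_rfl
    obtain ⟨e', he', he1⟩ := hasCoeffs_span_singleton htf.isSMulRegular hd
    rw [he.unique he' 1 (by omega), he1]
  | succ s ih =>
    intro R _ _ _ M _ _ _ Q x e hx hQ hd hdepth he
    have hQm : Q ≤ maximalIdeal R := by
      rw [hQ, Ideal.span_le]; rintro _ ⟨i, rfl⟩; exact hx i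
    have htf := (hdepth.noSmallSubmodule hQm hd).isTorsionFreeFor (by omega)
    obtain ⟨S, _, _, _, _, _, _, _, hm, c, y, hc, hy, hcy, hreg, N', hN'⟩ :=
      exists_superficial_extension hx hQ hd htf
    have hd' := hd.baseChange (S := S) hm
    have hdS := (hd'.quotient (c • ⊤))
    rw [hcy] at hdS
    refine ih (M := QuotSMulTop c (S ⊗[R] M)) hy rfl
      (hdS.of_sup_span QuotSMulTop.smul_eq_zero) ((hdepth.baseChange (S := S)).quotSMulTop hc hreg) ?_
    rw [← hilbertSamuel_sup_span QuotSMulTop.smul_eq_zero, ← hcy]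
    refine he.diff (N := N') fun n hn => ?_
    have := hN' n hn
    rw [hilbertSamuel_baseChange hm, hilbertSamuel_baseChange hm] at this
    rw [this]; push_cast; ring

/-- If the first Hilbert coefficient vanishes, then the largest submodule of smaller dimension has
codimension at least two, and the quotient by it still has vanishing first coefficient. -/
theorem exists_smallPart_of_coeff_one_eq_zero.{u, v} {R : Type u} [CommRing R] [IsLocalRing R]
    [IsNoetherianRing R] {M : Type (max u v)} [AddCommGroup M] [Module R M] [Module.Finite R M]
    {s : ℕ} {Q : Ideal R} {x : Fin (s + 1) → R} {e : ℕ → ℤ} (hx : ∀ i, x i ∈ maximalIdeal R)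
    (hQ : Q = Ideal.span (Set.range x)) (hd : IsIdealOfDefinition Q M)
    (he : HasCoeffs (fun n => (hilbertSamuel Q M n : ℤ)) (s + 1) e) (he1 : e 1 = 0) :
    ∃ P : Submodule R M, DimLT Q s P ∧ NoSmallSubmodule Q (s + 1) (M ⧸ P) ∧
      ∃ e', HasCoeffs (fun n => (hilbertSamuel Q (M ⧸ P) n : ℤ)) (s + 1) e' ∧ e' 1 = 0 := by
  obtain ⟨P, hP, -, hsm⟩ := exists_smallPart hd (s + 1)
  obtain ⟨e', he', he'1⟩ := exists_hasCoeffs_nonpos.{u, v} s hx hQ (hd.quotient P)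
  have hadd : ∀ n, (hilbertSamuel Q M n : ℤ) - hilbertSamuel Q (M ⧸ P) n =
      imageLength Q P.subtype n := fun n => by
    rw [hilbertSamuel_eq_add hd (f := P.subtype) (g := P.mkQ)
      (LinearMap.exact_subtype_mkQ P) (Submodule.mkQ_surjective _)]
    push_cast; ring
  have hp : HasCoeffs (fun n => (imageLength Q P.subtype n : ℤ)) (s + 1)
      (fun i => e i - e' i) := (he.sub he').congr (N := 0) fun n _ => hadd n
  have hg : GrowthLE (s + 1) (fun n => (imageLength Q P.subtype n : ℤ)) :=
    GrowthLE.of_le hP fun n => by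
      simpa using imageLength_le_hilbertSamuel (hd.submodule P) P.subtype n
  have hp0 : e 0 - e' 0 = 0 := hp.eq_zero_of_growthLE hg (i := 0) (by omega)
  have hp1 : e 1 - e' 1 ≤ 0 := hp.nonpos_of_nonneg (by omega) hp0 fun n => Int.natCast_nonneg _
  have he'0 : e' 1 = 0 := by omega
  refine ⟨P, growthLE_hilbertSamuel_of_imageLength hd P.subtype P.subtype_injective
    (hp.growthLE fun i hi => ?_), hsm, e', he', he'0⟩
  have : i = 0 ∨ i = 1 := by omega
  rcases this with rfl | rfl
  · exact hp0
  · omega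

/-- Vanishing of the first Hilbert coefficient forces the maximal depth. -/
theorem NoSmallSubmodule.hasDepthGE.{u, v} (s : ℕ) : ∀ {R : Type u} [CommRing R] [IsLocalRing R]
    [IsNoetherianRing R] {M : Type (max u v)} [AddCommGroup M] [Module R M] [Module.Finite R M]
    {Q : Ideal R} {x : Fin (s + 1) → R} {e : ℕ → ℤ}, IsChevalley.{max u v} R →
    (∀ i, x i ∈ maximalIdeal R) →
    Q = Ideal.span (Set.range x) → IsIdealOfDefinition Q M → NoSmallSubmodule Q (s + 1) M →
    HasCoeffs (fun n => (hilbertSamuel Q M n : ℤ)) (s + 1) e → e 1 = 0 →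
    HasDepthGE R (s + 1) M := by
  induction s with
  | zero =>
    intro R _ _ _ M _ _ _ Q x e hR hx hQ hd hM he he1
    rw [span_range_fin_one] at hQ
    subst hQ
    exact hasDepthGE_succ.2 ⟨x 0, hx 0, (hM.isTorsionFreeFor le_rfl).isSMulRegular,
      hasDepthGE_zero⟩
  | succ s ih =>
    intro R _ _ _ M _ _ _ Q x e hR hx hQ hd hM he he1
    have hQm : Q ≤ maximalIdeal R := by
      rw [hQ, Ideal.span_le]; rintro _ ⟨i, rfl⟩; exact hx i
    have htf := hM.isTorsionFreeFor (by omega)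
    obtain ⟨S, _, _, _, _, _, _, _, hm, c, y, hc, hy, hcy, hreg, N', hN'⟩ :=
      exists_superficial_extension hx hQ hd htf
    have hQm' : Q.map (algebraMap R S) ≤ maximalIdeal S := by
      rw [← hm]; exact Ideal.map_mono hQm
    have hRS := hR.of_finite hm
    have hMS := hM.baseChange (S := S) hd
    have hd' := hd.baseChange (S := S) hm
    have hdS := hd'.quotient (c • ⊤)
    rw [hcy] at hdS
    replace hdS := hdS.of_sup_span QuotSMulTop.smul_eq_zero
    have hA : HasCoeffs (fun n => (hilbertSamuel (Ideal.span (Set.range y))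
        (QuotSMulTop c (S ⊗[R] M)) n : ℤ)) (s + 1) e := by
      rw [← hilbertSamuel_sup_span QuotSMulTop.smul_eq_zero, ← hcy]
      refine he.diff (N := N') fun n hn => ?_
      have := hN' n hn
      rw [hilbertSamuel_baseChange hm, hilbertSamuel_baseChange hm] at this
      rw [this]; push_cast; ring
    obtain ⟨P, hPs, hsm, e', he', he'0⟩ := exists_smallPart_of_coeff_one_eq_zero hy rfl hdS hA he1
    have hdepth := ih hRS hy rfl (hdS.quotient P) hsm he' he'0
    have hPbot : P = ⊥ := by
      obtain rfl | ⟨t, rfl⟩ : s = 0 ∨ ∃ t, s = t + 1 := by cases s <;> simp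
      · have hym : Ideal.span (Set.range y) ≤ maximalIdeal S := by
          rw [Ideal.span_le]; rintro _ ⟨i, rfl⟩; exact hy i
        have := dimLT_zero_iff hym (hdS.submodule P) hPs
        exact Submodule.subsingleton_iff_eq_bot.1 this
      · refine eq_bot_of_hasDepthGE_quotient hRS hQm' hd'
          (fun K hK => hMS K (hK.mono (by omega))) ?_ hreg ?_ hdepth
        · rw [hcy]; exact Ideal.mem_sup_left (Ideal.mem_span_singleton_self c)
        · unfold DimLT
          rw [hcy, hilbertSamuel_sup_span fun u => Subtype.ext (QuotSMulTop.smul_eq_zero _)]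
          exact hPs
    refine HasDepthGE.of_baseChange (S := S) hm (hasDepthGE_succ.2 ⟨c, hc, hreg, ?_⟩)
    exact hdepth.congr (Submodule.quotEquivOfEqBot P hPbot)

end Coefficients

section Completion

variable {R : Type*} [CommRing R] [IsLocalRing R] [IsNoetherianRing R]

theorem exists_algebraMap_sub_mem_maximalIdeal (y : AdicCompletion (maximalIdeal R) R) :
    ∃ r : R, algebraMap R _ r - y ∈ maximalIdeal (AdicCompletion (maximalIdeal R) R) := by
  obtain ⟨u, hu⟩ := (AdicCompletion.residueField_map_bijective (R := R)).2 (residue _ y)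
  obtain ⟨r, rfl⟩ := residue_surjective u
  refine ⟨r, ?_⟩
  rw [ResidueField.map_residue] at hu
  exact (Ideal.Quotient.mk_eq_mk_iff_sub_mem _ _).1 hu

theorem MvPolynomial.span_range_X_pow_map_le {n : ℕ} {B : Type*} [CommRing B] (J : Ideal B)
    (φ : MvPolynomial (Fin n) R →+* B) (hφ : ∀ i, φ (MvPolynomial.X i) ∈ J) (k : ℕ) :
    MvPolynomial.idealOfVars (Fin n) R ^ k ≤ (J ^ k).comap φ := by
  rw [← Ideal.map_le_iff_le_comap, Ideal.map_pow]
  refine Ideal.pow_right_mono (Ideal.map_le_iff_le_comap.2 (Ideal.span_le.2 ?_)) k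
  rintro _ ⟨i, rfl⟩
  exact hφ i

/-- A complete local ring with finitely generated maximal ideal is Noetherian as soon as it is
dominated by a Noetherian local ring with the same residue field. -/
theorem isNoetherianRing_of_isAdicComplete {B : Type*} [CommRing B] [IsLocalRing B] [Algebra R B]
    [IsAdicComplete (maximalIdeal B) B]
    (hm : (maximalIdeal R).map (algebraMap R B) = maximalIdeal B)
    (hres : ∀ y : B, ∃ r : R, algebraMap R B r - y ∈ maximalIdeal B) : IsNoetherianRing B := by
  obtain ⟨n, g, hg⟩ := Submodule.fg_iff_exists_fin_generating_family.1
    ((isNoetherianRing_iff_ideal_fg R).1 inferInstance (maximalIdeal R))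
  set I := MvPolynomial.idealOfVars (Fin n) R
  have hI : I.FG := Submodule.fg_span (Set.finite_range _)
  set φ : MvPolynomial (Fin n) R →+* B :=
    (MvPolynomial.aeval (fun i => algebraMap R B (g i)) : _ →ₐ[R] B).toRingHom
  have hφX : ∀ i, φ (MvPolynomial.X i) = algebraMap R B (g i) := fun i => by simp [φ]
  have hφC : ∀ r, φ (MvPolynomial.C r) = algebraMap R B r := fun r => by simp [φ]
  have hmap : maximalIdeal B = Ideal.span (Set.range fun i => algebraMap R B (g i)) := by
    rw [← hm, ← hg]
    change Ideal.map _ (Ideal.span _) = _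
    rw [Ideal.map_span, ← Set.range_comp]; rfl
  have hφI := MvPolynomial.span_range_X_pow_map_le (maximalIdeal B) φ
    fun i => by rw [hφX, hmap]; exact Ideal.subset_span ⟨i, rfl⟩
  let f : ∀ k, AdicCompletion I (MvPolynomial (Fin n) R) →+* B ⧸ maximalIdeal B ^ k := fun k =>
    (Ideal.quotientMap _ φ (hφI k)).comp (AdicCompletion.evalₐ I k).toRingHom
  have hf : ∀ {k l : ℕ} (hle : k ≤ l), (Ideal.Quotient.factorPow (maximalIdeal B) hle).comp (f l) =
      f k := by
    intro k l hle
    ext x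
    obtain ⟨u, rfl⟩ := AdicCompletion.mk_surjective _ _ x
    have := AdicCompletion.Ideal.mk_eq_mk I hle u
    simp only [f, RingHom.comp_apply, AlgHom.toRingHom_eq_coe, RingHom.coe_coe,
      AdicCompletion.evalₐ_mk, ← this]
    rfl
  set F := IsAdicComplete.liftRingHom (maximalIdeal B) f hf
  have hF : ∀ p, F (algebraMap _ _ p) = φ p := fun p => by
    refine (IsHausdorff.eq_iff_smodEq (I := maximalIdeal B)).2 fun k => ?_
    rw [SModEq, smul_eq_mul, Ideal.mul_top]
    change Ideal.Quotient.mk _ _ = Ideal.Quotient.mk _ _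
    rw [IsAdicComplete.mk_liftRingHom]
    change Ideal.quotientMap _ φ (hφI k) (AdicCompletion.evalₐ I k (AdicCompletion.of I _ p)) = _
    rw [AdicCompletion.evalₐ_of, Ideal.quotientMap_mk]
  haveI : IsAdicComplete (I.map (algebraMap _ _)) (AdicCompletion I (MvPolynomial (Fin n) R)) :=
    AdicCompletion.isAdicComplete_self _ hI
  have hJ : (I.map (algebraMap _ (AdicCompletion I (MvPolynomial (Fin n) R)))).map F =
      maximalIdeal B := by
    have : F.comp (algebraMap _ _) = φ := RingHom.ext hF
    rw [Ideal.map_map, this, hmap]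
    change Ideal.map _ (Ideal.span _) = _
    rw [Ideal.map_span, ← Set.range_comp]
    congr 2
    exact funext hφX
  have hsurj : Function.Surjective F := by
    haveI : IsHausdorff ((I.map (algebraMap _
      (AdicCompletion I (MvPolynomial (Fin n) R)))).map F) B := by rw [hJ]; infer_instance
    refine surjective_of_mk_map_comp_surjective (I := I.map (algebraMap _
      (AdicCompletion I (MvPolynomial (Fin n) R)))) F fun y => ?_
    obtain ⟨y, rfl⟩ := Ideal.Quotient.mk_surjective y
    obtain ⟨r, hr⟩ := hres y
    refine ⟨algebraMap (MvPolynomial (Fin n) R) _ (MvPolynomial.C r), ?_⟩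
    rw [RingHom.comp_apply, hF, hφC, Ideal.Quotient.mk_eq_mk_iff_sub_mem, hJ]
    exact hr
  exact isNoetherianRing_of_surjective (MvPowerSeries (Fin n) R) _
    (F.comp (MvPowerSeries.toAdicCompletionAlgEquiv (Fin n) R).toRingEquiv.toRingHom)
    (hsurj.comp (MvPowerSeries.toAdicCompletionAlgEquiv (Fin n) R).surjective)

/-- The completion of a Noetherian local ring is Noetherian. -/
theorem isNoetherianRing_adicCompletion :
    IsNoetherianRing (AdicCompletion (maximalIdeal R) R) :=
  isNoetherianRing_of_isAdicComplete AdicCompletion.maximalIdeal_eq_map.symm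
    exists_algebraMap_sub_mem_maximalIdeal

theorem isPrecomplete_of_finite {A : Type*} [CommRing A] (I : Ideal A) [IsAdicComplete I A]
    (M : Type*) [AddCommGroup M] [Module A M] [Module.Finite A M] : IsPrecomplete I M := by
  refine (AdicCompletion.of_surjective_iff (I := I) (M := M)).1 fun z => ?_
  obtain ⟨t, rfl⟩ := AdicCompletion.ofTensorProduct_surjective_of_finite I M z
  induction t using TensorProduct.induction_on with
  | zero => exact ⟨0, by simp⟩
  | tmul a u =>
    obtain ⟨a, rfl⟩ := AdicCompletion.of_surjective I A a
    refine ⟨a • u, ?_⟩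
    rw [AdicCompletion.ofTensorProduct_tmul, map_smul]
    ext n
    rfl
  | add t t' h h' =>
    obtain ⟨u, hu⟩ := h
    obtain ⟨u', hu'⟩ := h'
    exact ⟨u + u', by rw [map_add, map_add, hu, hu']⟩

/-- Chevalley's theorem. -/
theorem IsChevalley.of_isAdicComplete.{v} {A : Type*} [CommRing A] [IsLocalRing A]
    [IsNoetherianRing A] [IsAdicComplete (maximalIdeal A) A] : IsChevalley.{v} A := by
  intro M _ _ _ V hV hV0 n₀
  have hpre := isPrecomplete_of_finite (maximalIdeal A) M
  obtain ⟨T, hT⟩ : ∃ T : ℕ → Submodule A M, ∀ n, T n = maximalIdeal A ^ n • ⊤ := ⟨_, fun _ => rfl⟩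
  rw [← hT]
  have hTanti : Antitone T := fun i j hij => by
    rw [hT, hT]; exact Submodule.smul_mono_left (Ideal.pow_le_pow_right hij)
  have hart : ∀ n, IsArtinian A (M ⧸ T n) := fun n => by
    refine (isFiniteLength_iff_isNoetherian_isArtinian.1
      (isFiniteLength_of_pow_le_annihilator (a := n) ?_)).2
    intro r hr
    refine Module.mem_annihilator.2 fun v => ?_
    obtain ⟨v, rfl⟩ := Submodule.mkQ_surjective _ v
    rw [← map_smul, Submodule.mkQ_apply, Submodule.Quotient.mk_eq_zero, hT]
    exact Submodule.smul_mem_smul hr trivial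
  have hstab : ∀ n, ∃ k, ∀ l, k ≤ l → V k ≤ V l ⊔ T n := fun n => by
    obtain ⟨k, hk⟩ := IsArtinian.monotone_stabilizes (R := A) (M := M ⧸ T n)
      ⟨fun l => OrderDual.toDual ((V l).map (T n).mkQ), fun i j hij => Submodule.map_mono (hV hij)⟩
    refine ⟨k, fun l hl => ?_⟩
    have := congrArg (Submodule.comap (T n).mkQ) (OrderDual.toDual.injective (hk l hl))
    rw [Submodule.comap_map_mkQ, Submodule.comap_map_mkQ, sup_comm, sup_comm _ (V l)] at this
    exact le_sup_left.trans this.le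
  choose k hk using hstab
  by_contra! hcon
  have hstep : ∀ n, ∀ u : M, (∀ l, u ∈ V l ⊔ T n) → ∃ w, (∀ l, w ∈ V l ⊔ T (n + 1)) ∧ w - u ∈ T n := by
    intro n u hu
    obtain ⟨w, hw, t, ht, rfl⟩ := Submodule.mem_sup.1 (hu (k (n + 1)))
    refine ⟨w, fun l => ?_, by simpa using ht⟩
    rcases le_total (k (n + 1)) l with h | h
    · exact hk _ l h hw
    · exact Submodule.mem_sup_left (hV h hw)
  obtain ⟨u₀, hu₀, hu₀'⟩ := SetLike.not_le_iff_exists.1 (hcon (k n₀))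
  have hu₀V : ∀ l, u₀ ∈ V l ⊔ T n₀ := fun l => by
    rcases le_total (k n₀) l with h | h
    · exact hk _ l h hu₀
    · exact Submodule.mem_sup_left (hV h hu₀)
  choose! w hw hwu using hstep
  let u : ℕ → M := fun j => Nat.rec u₀ (fun j v => w (n₀ + j) v) j
  have hus : ∀ j, u (j + 1) = w (n₀ + j) (u j) := fun j => rfl
  have hu : ∀ j, ∀ l, u j ∈ V l ⊔ T (n₀ + j) := fun j => by
    induction j with
    | zero => exact hu₀V
    | succ j ih => rw [hus]; exact hw _ _ ih
  have hdiff : ∀ j i, u (j + i) - u j ∈ T (n₀ + j) := fun j i => by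
    induction i with
    | zero => simp
    | succ i ih =>
      have := add_mem (hTanti (by omega) (hwu _ _ (hu (j + i)))) ih
      rw [← hus] at this
      simpa [add_assoc] using this
  obtain ⟨L, hL⟩ := hpre.prec (f := u) fun {i j} hij => by
    rw [SModEq.sub_mem, ← hT, ← neg_mem_iff, neg_sub]
    obtain ⟨d, rfl⟩ := Nat.exists_eq_add_of_le hij
    exact hTanti (by omega) (hdiff i d)
  have hL' : ∀ j, u j - L ∈ T j := fun j => by
    rw [hT, ← SModEq.sub_mem]; exact hL j
  have hT0 : ∀ K : Submodule A M, ∀ v, (∀ n, v ∈ K ⊔ T n) → v ∈ K := fun K v hv => by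
    rw [← Submodule.Quotient.mk_eq_zero, ← Submodule.mem_bot A,
      ← Ideal.iInf_pow_smul_eq_bot_of_isLocalRing (maximalIdeal A) (Ideal.IsPrime.ne_top'),
      Submodule.mem_iInf]
    refine fun n => ?_
    obtain ⟨a, ha, t, ht, rfl⟩ := Submodule.mem_sup.1 (hv n)
    rw [Submodule.Quotient.mk_add, (Submodule.Quotient.mk_eq_zero K).2 ha, zero_add]
    rw [hT] at ht
    exact pow_smul_top_le_comap _ K.mkQ n ht
  have hL0 : L = 0 := by
    rw [← Submodule.mem_bot A, ← hV0, Submodule.mem_iInf]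
    refine fun l => hT0 _ _ fun n => ?_
    have h1 : u n ∈ V l ⊔ T n := sup_le_sup_left (hTanti (by omega)) _ (hu n l)
    have := sub_mem h1 (Submodule.mem_sup_right (S := V l) (hL' n))
    simpa using this
  apply hu₀'
  have h1 := hdiff 0 n₀
  have h2 := hL' n₀
  rw [hL0, sub_zero] at h2
  simp only [zero_add, add_zero] at h1
  have h3 := sub_mem h2 h1
  rwa [sub_sub_cancel] at h3

end Completion

section Unmixed

open scoped TensorProduct Pointwise

theorem IsIdealOfDefinition.of_isFiniteLength {R M : Type*} [CommRing R] [IsLocalRing R]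
    [IsNoetherianRing R] [AddCommGroup M] [Module R M] [Module.Finite R M] {Q : Ideal R}
    (h : IsFiniteLength R (M ⧸ (Q • ⊤ : Submodule R M))) : IsIdealOfDefinition Q M := by
  set N := M ⧸ (Q • ⊤ : Submodule R M)
  have hart : IsArtinian R N := (isFiniteLength_iff_isNoetherian_isArtinian.1 h).2
  obtain ⟨a, ha⟩ : ∃ a, maximalIdeal R ^ a ≤ Module.annihilator R N := by
    obtain ⟨a, ha⟩ := IsArtinian.monotone_stabilizes (R := R) (M := N)
      ⟨fun l => OrderDual.toDual (maximalIdeal R ^ l • (⊤ : Submodule R N)), fun i j hij =>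
        Submodule.smul_mono_left (Ideal.pow_le_pow_right hij)⟩
    have hstab : (maximalIdeal R ^ a • ⊤ : Submodule R N) = maximalIdeal R ^ (a + 1) • ⊤ :=
      OrderDual.toDual.injective (ha (a + 1) (by omega))
    have hbot : (maximalIdeal R ^ a • ⊤ : Submodule R N) = ⊥ := by
      refine Submodule.eq_bot_of_le_smul_of_le_jacobson_bot (maximalIdeal R) _
        (IsNoetherian.noetherian _) ?_ (IsLocalRing.maximalIdeal_le_jacobson _)
      rw [← mul_smul, ← pow_succ', ← hstab]
    refine ⟨a, fun r hr => Module.mem_annihilator.2 fun v => ?_⟩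
    rw [← Submodule.mem_bot R, ← hbot]
    exact Submodule.smul_mem_smul hr trivial
  have hrad : Module.annihilator R N ≤ (Q ⊔ Module.annihilator R M).radical := by
    rw [← PrimeSpectrum.zeroLocus_subset_zeroLocus_iff, PrimeSpectrum.zeroLocus_sup,
      ← Module.support_eq_zeroLocus, ← Module.support_eq_zeroLocus, Module.support_quotient,
      Set.inter_comm]
  obtain ⟨b, hb⟩ := Ideal.exists_radical_pow_le_of_fg (Q ⊔ Module.annihilator R M)
    (IsNoetherian.noetherian _)
  refine ⟨a * b, ?_⟩
  rw [pow_mul]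
  exact (Ideal.pow_right_mono (ha.trans hrad) b).trans hb

theorem hilbertSamuel_eq_of_moduleLength_eq {R M : Type*} [CommRing R] [IsLocalRing R]
    [AddCommGroup M] [Module R M] {Q : Ideal R} {n l : ℕ}
    (h : moduleLength R (M ⧸ (Q ^ n • ⊤ : Submodule R M)) = (l : WithBot ℕ∞)) :
    hilbertSamuel Q M n = l := by
  rw [moduleLength, ← Module.coe_length] at h
  have : Module.length R (M ⧸ (Q ^ n • ⊤ : Submodule R M)) = (l : ℕ∞) := by exact_mod_cast h
  rw [hilbertSamuel, this, ENat.toNat_natCast]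

theorem HasHilbertCoeffsMod.hasCoeffs {R M : Type*} [CommRing R] [IsLocalRing R]
    [AddCommGroup M] [Module R M] {Q : Ideal R} {s : ℕ} {e : ℕ → ℤ}
    (h : HasHilbertCoeffsMod M Q s e) : HasCoeffs (fun n => (hilbertSamuel Q M n : ℤ)) s e := by
  obtain ⟨N, hN⟩ := h
  refine ⟨N, fun n hn => ?_⟩
  obtain ⟨l, hl, hle⟩ := hN n hn
  rw [← hle, ← hilbertSamuel_eq_of_moduleLength_eq hl]

theorem IsParameterIdealFor.isIdealOfDefinition {R M : Type*} [CommRing R] [IsLocalRing R]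
    [IsNoetherianRing R] [AddCommGroup M] [Module R M] [Module.Finite R M] {s : ℕ} {Q : Ideal R}
    (h : IsParameterIdealFor M s Q) : IsIdealOfDefinition Q M := by
  obtain ⟨-, l, hl⟩ := h
  refine .of_isFiniteLength (Module.length_ne_top_iff.1 fun htop => ?_)
  rw [moduleLength, ← Module.coe_length, htop] at hl
  exact absurd hl (by exact_mod_cast ENat.top_ne_natCast l)

/-- Along a chain of primes the order of growth drops. -/
theorem length_lt_of_dimLT {A : Type*} [CommRing A] [IsLocalRing A] [IsNoetherianRing A]
    {Q : Ideal A} (hQ : Q ≤ maximalIdeal A) (s : ℕ) : ∀ l : LTSeries (PrimeSpectrum A),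
    IsIdealOfDefinition Q (A ⧸ l.head.asIdeal) → DimLT Q s (A ⧸ l.head.asIdeal) →
    l.length < s := by
  induction s with
  | zero =>
    intro l hd h
    have := dimLT_zero_iff hQ hd h
    exact absurd (Ideal.Quotient.subsingleton_iff.1 this) l.head.isPrime.ne_top
  | succ s ih =>
    intro l hd h
    rcases Nat.eq_zero_or_pos l.length with hl | hl
    · omega
    have hl0 : l.length ≠ 0 := by omega
    set p := l.head
    set q := (l.tail hl0).head
    have hpq : p < q := by
      refine l.strictMono (Fin.lt_def.2 ?_)
      simp
    obtain ⟨x, hxq, hxp⟩ := SetLike.exists_of_lt (show p.asIdeal < q.asIdeal from hpq)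
    have hx : IsSMulRegular (A ⧸ p.asIdeal) x := by
      refine isSMulRegular_iff_right_eq_zero_of_smul.2 fun u hu => ?_
      obtain ⟨u, rfl⟩ := Ideal.Quotient.mk_surjective u
      rw [Algebra.smul_def, Ideal.Quotient.algebraMap_eq, ← map_mul,
        Ideal.Quotient.eq_zero_iff_mem] at hu
      exact Ideal.Quotient.eq_zero_iff_mem.2 ((p.isPrime.mem_or_mem hu).resolve_left hxp)
    have hle : p.asIdeal ≤ q.asIdeal := le_of_lt hpq
    have hsub : (x • ⊤ : Submodule A (A ⧸ p.asIdeal)) ≤ LinearMap.ker (Submodule.factor hle) := by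
      intro z hz
      obtain ⟨y, rfl⟩ := mem_smul_top_iff.1 hz
      obtain ⟨y, rfl⟩ := Submodule.mkQ_surjective _ y
      rw [LinearMap.mem_ker, map_smul, Submodule.factor_mk, ← map_smul,
        Submodule.mkQ_apply, Submodule.Quotient.mk_eq_zero]
      exact q.asIdeal.mul_mem_right _ hxq
    have hq : DimLT Q s (A ⧸ q.asIdeal) :=
      (DimLT.quotSMulTop hd hx h).of_surjective (hd.quotient _)
        (Submodule.liftQ _ _ hsub) fun z => by
          obtain ⟨y, rfl⟩ := Submodule.factor_surjective hle z
          exact ⟨Submodule.Quotient.mk y, rfl⟩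
    have := ih (l.tail hl0) (hd.of_surjective (Submodule.factor hle)
      (Submodule.factor_surjective hle)) hq
    simp at this
    omega

theorem ringKrullDim_quotient_ne_of_dimLT {A : Type*} [CommRing A] [IsLocalRing A]
    [IsNoetherianRing A] {Q : Ideal A} (hQ : Q ≤ maximalIdeal A) {s : ℕ} {p : Ideal A}
    (hd : IsIdealOfDefinition Q (A ⧸ p)) (h : DimLT Q s (A ⧸ p)) :
    ringKrullDim (A ⧸ p) ≠ s := by
  intro hdim
  obtain ⟨l, hl⟩ := Order.le_krullDim_iff.1 hdim.ge
  have hsurj : Function.Surjective (Ideal.Quotient.mk p) := Ideal.Quotient.mk_surjective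
  set l' := l.map (PrimeSpectrum.comap (Ideal.Quotient.mk p)) fun a b hab =>
      lt_of_le_of_ne (Ideal.comap_mono hab.le) fun hne => hab.ne
        (PrimeSpectrum.comap_injective_of_surjective _ hsurj hne)
  have hle : p ≤ l'.head.asIdeal := fun r hr => by
    change Ideal.Quotient.mk p r ∈ l.head.asIdeal
    rw [Ideal.Quotient.eq_zero_iff_mem.2 hr]
    exact zero_mem _
  have := length_lt_of_dimLT hQ s l' (hd.of_surjective (Submodule.factor hle)
      (Submodule.factor_surjective hle)) (h.of_surjective hd (Submodule.factor hle)
      (Submodule.factor_surjective hle))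
  have h2 : l'.length = l.length := rfl
  omega

theorem IsUnmixedModule.noSmallSubmodule.{u} {R M : Type u} [CommRing R] [IsLocalRing R]
    [IsNoetherianRing R] [IsNoetherianRing (AdicCompletion (maximalIdeal R) R)]
    [AddCommGroup M] [Module R M] [Module.Finite R M] {s : ℕ}
    (h : IsUnmixedModule R M s) {Q : Ideal (AdicCompletion (maximalIdeal R) R)}
    (hQ : Q ≤ maximalIdeal _)
    (hd : IsIdealOfDefinition Q (AdicCompletion (maximalIdeal R) R ⊗[R] M)) :
    NoSmallSubmodule Q s (AdicCompletion (maximalIdeal R) R ⊗[R] M) := by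
  intro K hK
  by_contra hbot
  have : Nontrivial K := Submodule.nontrivial_iff_ne_bot.2 hbot
  obtain ⟨p, hp⟩ := associatedPrimes.nonempty (AdicCompletion (maximalIdeal R) R) K
  have hmem : p ∈ associatedPrimes (AdicCompletion (maximalIdeal R) R)
      (AdicCompletion (maximalIdeal R) M) :=
    associatedPrimes.subset_of_injective (f :=
      (AdicCompletion.ofTensorProductEquivOfFiniteNoetherian (maximalIdeal R) M).toLinearMap ∘ₗ
      K.subtype) (fun a b hab => K.subtype_injective
        ((AdicCompletion.ofTensorProductEquivOfFiniteNoetherian _ M).injective hab)) hp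
  obtain ⟨-, f, hf⟩ := (isAssociatedPrime_iff_exists_injective_linearMap _ _).1 hp
  have hdK := hd.submodule K
  exact ringKrullDim_quotient_ne_of_dimLT hQ (hdK.of_injective f hf)
    (hK.of_injective hdK f hf) (h p hmem)

theorem IsUnmixedModule.congr {R M N : Type*} [CommRing R] [IsLocalRing R]
    [AddCommGroup M] [Module R M] [AddCommGroup N] [Module R N] {s : ℕ} (e : M ≃ₗ[R] N)
    (h : IsUnmixedModule R M s) : IsUnmixedModule R N s := fun p hp =>
  h p (by rwa [LinearEquiv.AssociatedPrimes.eq (AdicCompletion.congr (maximalIdeal R) e)])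

theorem IsUnmixedModule.hasDepthGE.{u} {R M : Type u} [CommRing R] [IsLocalRing R]
    [IsNoetherianRing R] [AddCommGroup M] [Module R M] [Module.Finite R M] {s : ℕ}
    (h : IsUnmixedModule R M (s + 1)) {Q : Ideal R} {x : Fin (s + 1) → R} {e : ℕ → ℤ}
    (hx : ∀ i, x i ∈ maximalIdeal R) (hQ : Q = Ideal.span (Set.range x))
    (hd : IsIdealOfDefinition Q M)
    (he : HasCoeffs (fun n => (hilbertSamuel Q M n : ℤ)) (s + 1) e) (he1 : e 1 = 0) :
    HasDepthGE R (s + 1) M := by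
  have hnoeth := isNoetherianRing_adicCompletion (R := R)
  have : Module.Flat R (AdicCompletion (maximalIdeal R) R) :=
    AdicCompletion.flat_of_isNoetherian _
  have hm := (AdicCompletion.maximalIdeal_eq_map (R := R)).symm
  have hQm : Q.map (algebraMap R (AdicCompletion (maximalIdeal R) R)) ≤ maximalIdeal _ := by
    rw [← hm]
    refine Ideal.map_mono ?_
    rw [hQ, Ideal.span_le]; rintro _ ⟨i, rfl⟩; exact hx i
  have hd' := hd.baseChange (S := AdicCompletion (maximalIdeal R) R) hm
  refine HasDepthGE.of_baseChange (S := AdicCompletion (maximalIdeal R) R) hm ?_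
  refine NoSmallSubmodule.hasDepthGE.{u, u} s (Q := Q.map (algebraMap R _))
    (x := fun i => algebraMap R _ (x i)) (e := e)
    IsChevalley.of_isAdicComplete (fun i => ?_) ?_ hd' (h.noSmallSubmodule hQm hd') ?_ he1
  · rw [← hm]; exact Ideal.mem_map_of_mem _ (hx i)
  · rw [hQ, Ideal.map_span, ← Set.range_comp]; rfl
  · convert he using 3
    rw [hilbertSamuel_baseChange hm]

theorem IsCohenMacaulayModule.hasDepthGE {R M : Type*} [CommRing R] [IsLocalRing R]
    [AddCommGroup M] [Module R M] {s : ℕ} (h : IsCohenMacaulayModule R M s) :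
    HasDepthGE R s M := by
  obtain ⟨rs, h1, h2, h3⟩ := h
  exact ⟨rs, h1, h2.toIsWeaklyRegular, h3⟩

theorem HasDepthGE.isCohenMacaulayModule {R M : Type*} [CommRing R] [IsLocalRing R]
    [IsNoetherianRing R] [AddCommGroup M] [Module R M] [Module.Finite R M] [Nontrivial M] {s : ℕ}
    (h : HasDepthGE R s M) : IsCohenMacaulayModule R M s := by
  obtain ⟨rs, h1, h2, h3⟩ := h
  exact ⟨rs, h1, (IsLocalRing.isRegular_iff_isWeaklyRegular_of_subset_maximalIdeal h1).2 h2, h3⟩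

end Unmixed

/-- **Ghezzi–Goto–Hong–Ozeki–Phuong–Vasconcelos, Theorem 3.1**.  Let `(R,m)` be a
Noetherian local ring, `M` a finitely generated `R`-module of dimension `s ≥ 2`, and `Q` a
parameter ideal for `M`.  If `M` is unmixed then `M` is Cohen-Macaulay iff `e₁(Q,M) = 0`. -/
theorem vanishing_conjecture_for_modules
    {R M : Type*} [CommRing R] [IsNoetherianRing R] [IsLocalRing R]
    [AddCommGroup M] [Module R M] [Module.Finite R M]
    (s : ℕ) (hs : 2 ≤ s)
    (hdimM : ringKrullDim (R ⧸ Module.annihilator R M) = s)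
    (Q : Ideal R) (hQ : IsParameterIdealFor M s Q)
    (hunmixed : IsUnmixedModule R M s)
    (e : ℕ → ℤ) (he : HasHilbertCoeffsMod M Q s e) :
    IsCohenMacaulayModule R M s ↔ e 1 = 0 := by
  have hd := hQ.isIdealOfDefinition
  have hc := he.hasCoeffs
  obtain ⟨⟨x, hx, hQx⟩, -⟩ := hQ
  have : Nontrivial M := by
    by_contra hM
    rw [not_nontrivial_iff_subsingleton, ← Module.annihilator_eq_top_iff (R := R)] at hM
    have := Ideal.Quotient.subsingleton_iff.2 hM
    rw [ringKrullDim_eq_bot_of_subsingleton] at hdimM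
    exact absurd hdimM.symm (WithBot.natCast_ne_bot s)
  obtain ⟨s, rfl⟩ : ∃ t, s = t + 1 := ⟨s - 1, by omega⟩
  obtain ⟨n, f, hf⟩ := Module.Finite.exists_fin' R M
  have ε : ((Fin n → R) ⧸ LinearMap.ker f) ≃ₗ[R] M := f.quotKerEquivOfSurjective hf
  have hd' := hd.of_injective ε.toLinearMap ε.injective
  simp_rw [← hilbertSamuel_congr Q ε] at hc
  refine ⟨fun h => ?_, fun h1 => ?_⟩
  · exact (h.hasDepthGE.congr ε.symm).coeff_one_eq_zero s hx hQx hd' hc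
  · exact (((hunmixed.congr ε.symm).hasDepthGE hx hQx hd' hc h1).congr ε).isCohenMacaulayModule
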